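/- arXiv:2405.11556 — 12 statements merged into one kernel-verified Lean document; each statement's English description precedes it below -/
import Mathlib

section
/- Let A be an n×n positive semidefinite matrix all of whose entries are real, and let k be a positive integer. Then A admits a decomposition A = Σ_j v_j v_j* with complex vectors v_j ∈ ℂⁿ each having at most k nonzero entries if and only if A admits a decomposition A = Σ_j w_j w_jᵀ with real vectors w_j ∈ ℝⁿ each having at most k nonzero entries. Consequently, the factor width of a real positive semidefinite matrix does not depend on whether the ground field is ℝ or ℂ. -/
open Matrix
open scoped ComplexOrder

variable {𝕜 : Type*} [RCLike 𝕜] {n : ℕ}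

/-- `A` has a decomposition as a sum of `r` outer products `v_j v_j*` where each
vector `v_j` has at most `k` nonzero entries. -/
def HasFWDecomp (k r : ℕ) (A : Matrix (Fin n) (Fin n) 𝕜) : Prop :=
  ∃ v : Fin r → (Fin n → 𝕜),
    (∀ j, ({i | v j i ≠ 0} : Set (Fin n)).ncard ≤ k) ∧
    A = ∑ j, Matrix.vecMulVec (v j) (star (v j))

/-- `A` has factor width at most `k`. -/
def FactorWidthAtMost (k : ℕ) (A : Matrix (Fin n) (Fin n) 𝕜) : Prop :=
  ∃ r, HasFWDecomp k r A

/-- The factor-width-`k` rank of `A`: the least number of terms in a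
factor-width-`k` decomposition of `A`. -/
noncomputable def fran (k : ℕ) (A : Matrix (Fin n) (Fin n) 𝕜) : ℕ :=
  sInf {r | HasFWDecomp k r A}

/-- The factor width of `A`: the least `k` such that `A` has factor width at most `k`. -/
noncomputable def FactorWidth (A : Matrix (Fin n) (Fin n) 𝕜) : ℕ :=
  sInf {k | FactorWidthAtMost k A}

theorem HasFWDecomp.map_ofReal {k r : ℕ} {A : Matrix (Fin n) (Fin n) ℝ}
    (h : HasFWDecomp k r A) : HasFWDecomp k r (A.map (Complex.ofReal ·)) := by
  obtain ⟨v, hv, rfl⟩ := h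
  refine ⟨fun j i => (v j i : ℂ), fun j => by simpa using hv j, ?_⟩
  ext a b
  simp [Matrix.sum_apply, Matrix.vecMulVec_apply]

/-- Splitting each complex vector into its real and imaginary parts gives a real decomposition
with twice as many terms. -/
theorem HasFWDecomp.of_map_ofReal {k r : ℕ} {A : Matrix (Fin n) (Fin n) ℝ}
    (h : HasFWDecomp k r (A.map (Complex.ofReal ·))) : HasFWDecomp k (r + r) A := by
  obtain ⟨v, hv, hA⟩ := h
  refine ⟨Fin.append (fun j i => (v j i).re) (fun j i => (v j i).im), fun j => ?_, ?_⟩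
  · refine Fin.addCases (fun j => ?_) (fun j => ?_) j
    · simp only [Fin.append_left]
      exact (Set.ncard_le_ncard (Set.ofPred_subset_ofPred.2 fun i hi h0 => hi (by simp [h0]))
        (Set.toFinite _)).trans (hv j)
    · simp only [Fin.append_right]
      exact (Set.ncard_le_ncard (Set.ofPred_subset_ofPred.2 fun i hi h0 => hi (by simp [h0]))
        (Set.toFinite _)).trans (hv j)
  · ext a b
    have hab := congrArg Complex.re (congrFun (congrFun hA a) b)
    rw [Fin.sum_univ_add]
    simp only [Fin.append_left, Fin.append_right]
    simpa [Matrix.sum_apply, Matrix.vecMulVec_apply, Finset.sum_add_distrib] using hab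

theorem factorWidthAtMost_map_ofReal_iff (k : ℕ) (A : Matrix (Fin n) (Fin n) ℝ) :
    FactorWidthAtMost k (A.map (Complex.ofReal ·)) ↔ FactorWidthAtMost k A :=
  ⟨fun ⟨_, h⟩ => ⟨_, h.of_map_ofReal⟩, fun ⟨_, h⟩ => ⟨_, h.map_ofReal⟩⟩

theorem factorWidth_real_complex (k : ℕ) (hk : 0 < k)
    (A : Matrix (Fin n) (Fin n) ℝ) (hA : A.PosSemidef) :
    (FactorWidthAtMost k (A.map (Complex.ofReal ·)) ↔ FactorWidthAtMost k A) ∧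
    FactorWidth (A.map (Complex.ofReal ·)) = FactorWidth A := by
  refine ⟨factorWidthAtMost_map_ofReal_iff k A, ?_⟩
  simp only [FactorWidth, factorWidthAtMost_map_ofReal_iff]
end

section
/- If an n×n positive semidefinite matrix A over F (F = ℝ or ℂ) has bandwidth at most k, then A has factor width at most k. -/
open Matrix
open scoped ComplexOrder

variable {𝕜 : Type*} [RCLike 𝕜] {n : ℕ}

theorem FactorWidthAtMost.of_sub_vecMulVec {k : ℕ} {A : Matrix (Fin n) (Fin n) 𝕜}
    (v : Fin n → 𝕜) (hv : ({i | v i ≠ 0} : Set (Fin n)).ncard ≤ k)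
    (h : FactorWidthAtMost k (A - vecMulVec v (star v))) : FactorWidthAtMost k A := by
  obtain ⟨r, w, hw, hsum⟩ := h
  refine ⟨r + 1, Fin.cons v w, fun j => ?_, ?_⟩
  · cases j using Fin.cases with
    | zero => simpa using hv
    | succ j => simpa using hw j
  · simp only [Fin.sum_univ_succ, Fin.cons_zero, Fin.cons_succ, ← hsum]
    abel

/-- A positive semidefinite matrix with a zero diagonal entry vanishes on the corresponding row. -/
theorem Matrix.PosSemidef.row_eq_zero_of_diag_eq_zero {A : Matrix (Fin n) (Fin n) 𝕜}
    (hA : A.PosSemidef) {m : Fin n} (hm : A m m = 0) (j : Fin n) : A m j = 0 := by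
  have h := (hA.dotProduct_mulVec_zero_iff (Pi.single m 1)).1 (by
    simp [hm])
  have hj : A j m = 0 := by simpa using congrFun h j
  rw [← hA.1.apply, hj, star_zero]

/-- Subtracting the rank-one matrix that clears the column of a nonzero pivot preserves positive
semidefiniteness. -/
theorem Matrix.PosSemidef.sub_smul_vecMulVec_col {A : Matrix (Fin n) (Fin n) 𝕜}
    (hA : A.PosSemidef) {m : Fin n} (hm : A m m ≠ 0) :
    (A - (A m m)⁻¹ • vecMulVec (A.col m) (star (A.col m))).PosSemidef := by
  set a := A.col m with ha
  set S := A - (A m m)⁻¹ • vecMulVec a (star a) with hS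
  set P : Matrix (Fin n) (Fin n) 𝕜 :=
    1 - (A m m)⁻¹ • vecMulVec (Pi.single m 1) (star a) with hP
  have hAP : A * P = S := by
    rw [hP, hS, mul_sub, mul_one, Matrix.mul_smul, mul_vecMulVec, mulVec_single_one]
  have hrow : Pi.single m 1 ᵥ* S = 0 := by
    ext j
    simp [hS, ha, vecMulVec_apply, hA.1.apply, hm]
  have hPS : Pᴴ * S = S := by
    rw [hP, conjTranspose_sub, conjTranspose_one, conjTranspose_smul, conjTranspose_vecMulVec,
      star_star, sub_mul, one_mul, Matrix.smul_mul, vecMulVec_mul, ← Pi.single_star, star_one,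
      hrow, vecMulVec_zero, smul_zero, sub_zero]
  rw [← hPS, ← hAP, ← Matrix.mul_assoc]
  exact hA.conjTranspose_mul_mul_same P

theorem Fin.ncard_le_of_forall_mem_Ico {s : Set (Fin n)} {m k : ℕ}
    (h : ∀ i ∈ s, m ≤ (i : ℕ) ∧ (i : ℕ) < m + k) : s.ncard ≤ k := by
  have h' := Set.ncard_le_ncard_of_injOn (t := (Finset.Ico m (m + k) : Set ℕ))
    (fun i : Fin n => (i : ℕ)) (fun i hi => by simpa using h i hi)
    (Fin.val_injective.injOn) (Finset.finite_toSet _)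
  rw [Set.ncard_coe_finset, Nat.card_Ico] at h'
  omega

theorem factorWidthAtMost_of_bandwidth_of_rows_eq_zero (k d m : ℕ) (hmd : m + d = n)
    (A : Matrix (Fin n) (Fin n) 𝕜) (hA : A.PosSemidef)
    (hband : ∀ i j : Fin n, (k : ℤ) ≤ |(i : ℤ) - (j : ℤ)| → A i j = 0)
    (hzero : ∀ i j : Fin n, (i : ℕ) < m → A i j = 0) :
    FactorWidthAtMost k A := by
  induction d generalizing m A with
  | zero =>
    refine ⟨0, Fin.elim0, fun j => j.elim0, ?_⟩
    ext i j
    simp [hzero i j (by omega)]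
  | succ d ih =>
    let p : Fin n := ⟨m, by omega⟩
    have hrows : ∀ {B : Matrix (Fin n) (Fin n) 𝕜}, (∀ j, B p j = 0) →
        (∀ i j : Fin n, (i : ℕ) < m → B i j = 0) →
        ∀ i j : Fin n, (i : ℕ) < m + 1 → B i j = 0 := by
      intro B hp hB i j hi
      rcases Nat.lt_succ_iff_lt_or_eq.1 hi with hi | hi
      · exact hB i j hi
      · rw [show i = p from Fin.ext hi]
        exact hp j
    by_cases hp : A p p = 0
    · exact ih (m + 1) (by omega) A hA hband
        (hrows (hA.row_eq_zero_of_diag_eq_zero hp) hzero)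
    have hcol : ∀ i : Fin n, A i p ≠ 0 → m ≤ (i : ℕ) ∧ (i : ℕ) < m + k := by
      intro i hi
      have h1 : m ≤ (i : ℕ) := not_lt.1 fun h => hi (hzero i p h)
      have h2 : |(i : ℤ) - (m : ℤ)| < k := not_le.1 fun h => hi (hband i p h)
      have h3 := abs_lt.1 h2
      omega
    obtain ⟨c, hc⟩ : ∃ c : 𝕜, c * star c = (A p p)⁻¹ := by
      obtain ⟨x, hx, hxp⟩ := RCLike.nonneg_iff_exists_ofReal.1 (hA.diag_nonneg (i := p))
      refine ⟨((√x)⁻¹ : ℝ), ?_⟩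
      rw [← hxp, RCLike.star_def, RCLike.conj_ofReal, ← RCLike.ofReal_mul, ← mul_inv,
        Real.mul_self_sqrt hx, RCLike.ofReal_inv]
    have hcv : vecMulVec (c • A.col p) (star (c • A.col p)) =
        (A p p)⁻¹ • vecMulVec (A.col p) (star (A.col p)) := by
      ext i j
      simp only [vecMulVec_apply, Pi.smul_apply, Pi.star_apply, smul_eq_mul, star_mul',
        Matrix.smul_apply, ← hc]
      ring
    refine .of_sub_vecMulVec (c • A.col p)
      (Fin.ncard_le_of_forall_mem_Ico (m := m) fun i hi => hcol i ?_) ?_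
    · exact fun h => hi (by simp [h])
    rw [hcv]
    refine ih (m + 1) (by omega) _ (hA.sub_smul_vecMulVec_col hp) (fun i j hij => ?_)
      (hrows (fun j => ?_) fun i j hi => ?_)
    · have h : A i p = 0 ∨ A j p = 0 := by
        by_contra! h
        have hi := hcol i h.1
        have hj := hcol j h.2
        have hlt : |(i : ℤ) - (j : ℤ)| < k := abs_lt.2 ⟨by omega, by omega⟩
        omega
      rcases h with h | h <;> simp [vecMulVec_apply, hband i j hij, h]
    · simp [vecMulVec_apply, hA.1.apply, hp]
    · simp [vecMulVec_apply, hzero i _ hi]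

theorem factorWidthAtMost_of_bandwidth (k : ℕ) (hk : 0 < k)
    (A : Matrix (Fin n) (Fin n) 𝕜) (hA : A.PosSemidef)
    (hband : ∀ i j : Fin n, (k : ℤ) ≤ |(i : ℤ) - (j : ℤ)| → A i j = 0) :
    FactorWidthAtMost k A := by
  exact factorWidthAtMost_of_bandwidth_of_rows_eq_zero k n 0 (Nat.zero_add n) A hA hband
    fun _ _ h => absurd h (Nat.not_lt_zero _)
end

section
/- If an n×n positive semidefinite matrix A over F (F = ℝ or ℂ) has bandwidth at most k, then its factor-width-k rank equals its ordinary rank: fran_k(A) = rank(A). -/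
open Matrix
open scoped ComplexOrder

variable {𝕜 : Type*} [RCLike 𝕜] {n : ℕ}

/-- A row of a positive semidefinite matrix whose diagonal entry vanishes is zero. -/
lemma Matrix.PosSemidef.apply_eq_zero_of_diag_eq_zero {A : Matrix (Fin n) (Fin n) 𝕜}
    (hA : A.PosSemidef) {i : Fin n} (hi : A i i = 0) (j : Fin n) : A i j = 0 := by
  have h := (hA.dotProduct_mulVec_zero_iff (Pi.single i 1)).1 (by simp [hi])
  have hji : A j i = 0 := by simpa using congrFun h j
  rw [← hA.1.apply i j, hji, star_zero]

lemma Matrix.schur_complement_diag_eq_mul {A B : Matrix (Fin n) (Fin n) 𝕜} (i : Fin n)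
    (hB : ∀ j l, B j l = A j l - A j i * A i l / A i i) :
    B = A * (1 - vecMulVec (Pi.single i (A i i)⁻¹) (A i)) := by
  ext j l
  rw [Matrix.mul_sub, Matrix.mul_one, mul_vecMulVec, hB]
  simp [vecMulVec_apply, div_eq_mul_inv]

lemma Matrix.row_schur_complement_diag_eq_zero {A B : Matrix (Fin n) (Fin n) 𝕜} (i : Fin n)
    (hi : A i i ≠ 0) (hB : ∀ j l, B j l = A j l - A j i * A i l / A i i) : B i = 0 := by
  ext l
  rw [hB, mul_div_cancel_left₀ _ hi, sub_self, Pi.zero_apply]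

/-- The Schur complement of a diagonal entry is positive semidefinite for a positive
semidefinite matrix. -/
lemma Matrix.PosSemidef.schur_complement_diag {A : Matrix (Fin n) (Fin n) 𝕜}
    (hA : A.PosSemidef) (i : Fin n) {B : Matrix (Fin n) (Fin n) 𝕜} (hi : A i i ≠ 0)
    (hB : ∀ j l, B j l = A j l - A j i * A i l / A i i) : B.PosSemidef := by
  set P : Matrix (Fin n) (Fin n) 𝕜 := 1 - vecMulVec (Pi.single i (A i i)⁻¹) (A i)
  have hAP : A * P = B := (schur_complement_diag_eq_mul i hB).symm
  have hBi := row_schur_complement_diag_eq_zero i hi hB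
  have hPB : Pᴴ * B = B := by
    have hz : vecMulVec (star (A i)) (star (Pi.single i (A i i)⁻¹)) * B = 0 := by
      rw [vecMulVec_mul, ← Pi.single_star, single_vecMul]
      ext j l
      simp [vecMulVec_apply, Matrix.row, hBi]
    rw [conjTranspose_sub, conjTranspose_one, conjTranspose_vecMulVec, Matrix.sub_mul,
      Matrix.one_mul, hz, sub_zero]
  rw [← hPB, ← hAP, ← Matrix.mul_assoc]
  exact hA.conjTranspose_mul_mul_same P

lemma Matrix.rank_schur_complement_diag_lt {A B : Matrix (Fin n) (Fin n) 𝕜} (i : Fin n)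
    (hi : A i i ≠ 0) (hB : ∀ j l, B j l = A j l - A j i * A i l / A i i) :
    B.rank < A.rank := by
  have hBi := row_schur_complement_diag_eq_zero i hi hB
  refine Submodule.finrank_lt_finrank_of_lt (lt_of_le_of_ne ?_ fun h => hi ?_)
  · rw [schur_complement_diag_eq_mul i hB, mulVecLin_mul]
    exact LinearMap.range_comp_le_range _ _
  · have hmem : A *ᵥ Pi.single i 1 ∈ LinearMap.range A.mulVecLin := ⟨_, rfl⟩
    rw [← h] at hmem
    obtain ⟨x, hx⟩ := hmem
    simpa [mulVec, hBi] using (congrFun hx i).symm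

lemma HasFWDecomp.rank_le {k r : ℕ} {A : Matrix (Fin n) (Fin n) 𝕜} (h : HasFWDecomp k r A) :
    A.rank ≤ r := by
  obtain ⟨v, -, rfl⟩ := h
  have hmul : ∑ j, vecMulVec (v j) (star (v j)) = (of v)ᵀ * of fun j => star (v j) := by
    ext a b
    simp [Matrix.sum_apply, vecMulVec_apply, Matrix.mul_apply]
  rw [hmul]
  exact (rank_mul_le_left _ _).trans (rank_le_width _)

lemma HasFWDecomp.succ {k r : ℕ} {A : Matrix (Fin n) (Fin n) 𝕜} {w : Fin n → 𝕜}
    (hw : ({i | w i ≠ 0} : Set (Fin n)).ncard ≤ k)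
    (h : HasFWDecomp k r (A - vecMulVec w (star w))) : HasFWDecomp k (r + 1) A := by
  obtain ⟨v, hv, hsum⟩ := h
  refine ⟨Fin.cons w v, Fin.cases hw hv, ?_⟩
  rw [Fin.sum_univ_succ]
  simp only [Fin.cons_zero, Fin.cons_succ, ← hsum, add_sub_cancel]

lemma Fin.ncard_le_of_subset_window {s : Set (Fin n)} {i k : ℕ}
    (h : ∀ j ∈ s, i ≤ (j : ℕ) ∧ (j : ℕ) < i + k) : s.ncard ≤ k := by
  calc s.ncard = (Fin.val '' s).ncard := (Set.ncard_image_of_injective _ Fin.val_injective).symm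
    _ ≤ (Finset.Ico i (i + k) : Set ℕ).ncard := by
      refine Set.ncard_le_ncard ?_ (Finset.finite_toSet _)
      rintro _ ⟨j, hj, rfl⟩
      simpa using h j hj
    _ = k := by rw [Set.ncard_coe_finset]; simp

/-- Cholesky factorization of a banded positive semidefinite matrix: each step removes the first
nonzero row and column and preserves the bandwidth. -/
lemma Matrix.PosSemidef.exists_hasFWDecomp {k : ℕ} {A : Matrix (Fin n) (Fin n) 𝕜}
    (hA : A.PosSemidef)
    (hband : ∀ i j : Fin n, (k : ℤ) ≤ |(i : ℤ) - (j : ℤ)| → A i j = 0) :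
    ∃ r ≤ A.rank, HasFWDecomp k r A := by
  induction hr : A.rank using Nat.strong_induction_on generalizing A with
  | _ m ih =>
  by_cases hdiag : ∀ i, A i i = 0
  · refine ⟨0, Nat.zero_le _, Fin.elim0, fun j => j.elim0, ?_⟩
    ext i j
    simpa using hA.apply_eq_zero_of_diag_eq_zero (hdiag i) j
  push Not at hdiag
  obtain ⟨i, hi, hmin⟩ := WellFounded.has_min (wellFounded_lt (α := Fin n))
    {i | A i i ≠ 0} hdiag
  have hrow : ∀ l < i, ∀ j, A l j = 0 := fun l hl =>
    hA.apply_eq_zero_of_diag_eq_zero (by_contra fun h => hmin l h hl)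
  have hsymm : ∀ j l, A j l = 0 → A l j = 0 := fun j l h => by
    rw [← hA.1.apply l j, h, star_zero]
  have hre : 0 ≤ RCLike.re (A i i) := (RCLike.nonneg_iff.1 hA.diag_nonneg).1
  have hval : ((RCLike.re (A i i) : ℝ) : 𝕜) = A i i := RCLike.conj_eq_iff_re.1 (hA.1.apply i i)
  set w : Fin n → 𝕜 := fun j => A j i * ((√(RCLike.re (A i i)))⁻¹ : ℝ)
  have hentry : ∀ j l, (A - vecMulVec w (star w)) j l = A j l - A j i * A i l / A i i := by
    intro j l
    have hsq : (((√(RCLike.re (A i i)))⁻¹ : ℝ) : 𝕜) * ((√(RCLike.re (A i i)))⁻¹ : ℝ)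
        = (A i i)⁻¹ := by
      rw [← RCLike.ofReal_mul, ← mul_inv, Real.mul_self_sqrt hre, RCLike.ofReal_inv, hval]
    have hstar : star (w l) = A i l * ((√(RCLike.re (A i i)))⁻¹ : ℝ) := by
      rw [star_mul', hA.1.apply i l]
      congr 1
      exact RCLike.conj_ofReal _
    rw [Matrix.sub_apply, vecMulVec_apply, Pi.star_apply, hstar, div_eq_mul_inv, ← hsq]
    ring
  have hw : ({j | w j ≠ 0} : Set (Fin n)).ncard ≤ k := by
    refine Fin.ncard_le_of_subset_window (i := i) fun j hj => ?_
    have hji : A j i ≠ 0 := left_ne_zero_of_mul hj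
    have h1 : ¬ j < i := fun h => hji (hrow j h i)
    have h2 : ¬ (k : ℤ) ≤ |(j : ℤ) - (i : ℤ)| := fun h => hji (hband j i h)
    rw [Fin.lt_def] at h1
    rw [le_abs] at h2
    omega
  have hlt := Matrix.rank_schur_complement_diag_lt i hi hentry
  obtain ⟨r, hrle, hdec⟩ := ih _ (hr ▸ hlt) (hA.schur_complement_diag i hi hentry) (by
    intro j l hjl
    rw [hentry, hband j l hjl, zero_sub, neg_eq_zero, div_eq_zero_iff, mul_eq_zero]
    refine Or.inl (by_contra fun hne => ?_)
    push Not at hne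
    have hj : ¬ j < i := fun h => hne.1 (hrow j h i)
    have hl : ¬ l < i := fun h => hne.2 (hsymm _ _ (hrow l h i))
    have hj' : ¬ (k : ℤ) ≤ |(j : ℤ) - (i : ℤ)| := fun h => hne.1 (hband j i h)
    have hl' : ¬ (k : ℤ) ≤ |(i : ℤ) - (l : ℤ)| := fun h => hne.2 (hband i l h)
    rw [Fin.lt_def] at hj hl
    rw [le_abs] at hj' hl' hjl
    omega) rfl
  exact ⟨r + 1, by omega, hdec.succ hw⟩

theorem fran_eq_rank_of_bandwidth (k : ℕ) (hk : 0 < k)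
    (A : Matrix (Fin n) (Fin n) 𝕜) (hA : A.PosSemidef)
    (hband : ∀ i j : Fin n, (k : ℤ) ≤ |(i : ℤ) - (j : ℤ)| → A i j = 0) :
    fran k A = A.rank := by
  obtain ⟨r, hr, hdec⟩ := hA.exists_hasFWDecomp hband
  exact le_antisymm ((Nat.sInf_le hdec).trans hr)
    (HasFWDecomp.rank_le (Nat.sInf_mem (s := {r | HasFWDecomp k r A}) ⟨r, hdec⟩))
end

section
/- If an n×n positive semidefinite matrix A over F (F = ℝ or ℂ) is diagonally dominant, then A has factor width at most 2. -/
open Matrix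
open scoped ComplexOrder

variable {𝕜 : Type*} [RCLike 𝕜] {n : ℕ}

/-- A decomposition indexed by an arbitrary finite type witnesses the factor width bound. -/
theorem factorWidthAtMost_of_eq_sum {ι : Type*} [Fintype ι] {k : ℕ}
    {A : Matrix (Fin n) (Fin n) 𝕜} (v : ι → Fin n → 𝕜)
    (hv : ∀ j, ({i | v j i ≠ 0} : Set (Fin n)).ncard ≤ k)
    (hA : A = ∑ j, vecMulVec (v j) (star (v j))) : FactorWidthAtMost k A := by
  let e := Fintype.equivFin ι
  refine ⟨Fintype.card ι, fun j => v (e.symm j), fun j => hv _, ?_⟩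
  rw [hA, e.symm.sum_comp fun j => vecMulVec (v j) (star (v j))]

/-- The positive semidefinite matrix with diagonal `‖a‖ / 2, ‖a‖ / 2` and off-diagonal entry
`a / 2` is a rank-one outer product. -/
theorem exists_mul_star_eq_half (a : 𝕜) :
    ∃ s t : 𝕜, s * star s = (‖a‖ : 𝕜) / 2 ∧ t * star t = (‖a‖ : 𝕜) / 2 ∧ s * star t = a / 2 := by
  by_cases ha : a = 0
  · exact ⟨0, 0, by simp [ha]⟩
  have hpos : 0 < ‖a‖ / 2 := by positivity
  set r : ℝ := √(‖a‖ / 2) with hr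
  have hr0 : (r : 𝕜) ≠ 0 := by
    exact_mod_cast (Real.sqrt_pos.2 hpos).ne'
  have hrr : (r : 𝕜) * r = (‖a‖ : 𝕜) / 2 := by
    rw [← RCLike.ofReal_mul, hr, Real.mul_self_sqrt hpos.le]
    push_cast
    rfl
  have ha0 : (‖a‖ : 𝕜) ≠ 0 := by exact_mod_cast norm_ne_zero_iff.2 ha
  have hconj : star a * a = (‖a‖ : 𝕜) ^ 2 := RCLike.conj_mul a
  have hstar2 : star (2 : 𝕜) = 2 := star_ofNat 2
  have hstarr : star (r : 𝕜) = r := RCLike.conj_ofReal r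
  refine ⟨r, star a / (2 * r), by rw [hstarr, hrr], ?_, ?_⟩
  · rw [star_div₀, star_mul, star_star, hstar2, hstarr, div_mul_div_comm, hconj,
      show 2 * (r : 𝕜) * (r * 2) = 4 * (r * r) by ring, hrr]
    field_simp
    norm_num
  · rw [star_div₀, star_mul, star_star, hstar2, hstarr]
    field_simp

theorem factorWidthAtMost_two_of_diagDominant (A : Matrix (Fin n) (Fin n) 𝕜)
    (hA : A.PosSemidef)
    (hdd : ∀ i, ∑ j ∈ Finset.univ.erase i, ‖A i j‖ ≤ ‖A i i‖) :
    FactorWidthAtMost 2 A := by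
  set B : Matrix (Fin n) (Fin n) 𝕜 := A - diagonal fun i => A i i with hB
  have hBdiag (i) : B i i = 0 := by simp [hB]
  have hBoff {i j} (h : j ≠ i) : B i j = A i j := by simp [hB, diagonal_apply_ne' _ h]
  have hBstar (i j) : star (B i j) = B j i := by
    by_cases h : j = i
    · subst h; simp [hBdiag]
    · rw [hBoff h, hBoff (Ne.symm h), hA.isHermitian.apply]
  have hBsum (i) : ∑ j, ‖B i j‖ ≤ RCLike.re (A i i) := by
    have hre : ‖A i i‖ = RCLike.re (A i i) := by
      conv_lhs => rw [← hA.isHermitian.coe_re_apply_self]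
      exact RCLike.norm_of_nonneg (RCLike.nonneg_iff.1 hA.diag_nonneg).1
    rw [← Finset.add_sum_erase _ _ (Finset.mem_univ i), hBdiag, norm_zero, zero_add, ← hre]
    refine le_trans (Finset.sum_le_sum fun j hj => ?_) (hdd i)
    rw [hBoff (Finset.ne_of_mem_erase hj)]
  have hBnorm (i j) : ‖B i j‖ = ‖B j i‖ := by rw [← hBstar, norm_star]
  choose s t hs ht hst using fun i j => exists_mul_star_eq_half (B i j)
  let d (i : Fin n) : 𝕜 := (√(RCLike.re (A i i) - ∑ j, ‖B i j‖) : ℝ)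
  have hd (i) : d i * star (d i) = A i i - ((∑ j, ‖B i j‖ : ℝ) : 𝕜) := by
    simp only [d, RCLike.star_def, RCLike.conj_ofReal]
    rw [← RCLike.ofReal_mul, Real.mul_self_sqrt (sub_nonneg.2 (hBsum i)), RCLike.ofReal_sub,
      hA.isHermitian.coe_re_apply_self]
  refine factorWidthAtMost_of_eq_sum (ι := (Fin n × Fin n) ⊕ Fin n)
    (Sum.elim (fun p => Pi.single p.1 (s p.1 p.2) + Pi.single p.2 (t p.1 p.2))
      fun i => Pi.single i (d i))
    ?_ ?_
  · rintro (p | i)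
    · refine (Set.ncard_le_ncard (t := {p.1, p.2}) ?_ (Set.toFinite _)).trans
        ((Set.ncard_insert_le _ _).trans (by simp))
      intro x hx
      by_contra h
      simp only [Set.mem_insert_iff, Set.mem_singleton_iff, not_or] at h
      simp [h.1, h.2] at hx
    · refine (Set.ncard_le_ncard (t := {i}) ?_ (Set.toFinite _)).trans (by simp)
      intro x hx
      by_contra h
      simp only [Set.mem_singleton_iff] at h
      simp [h] at hx
  · have hts (i j) : t i j * star (s i j) = B j i / 2 := by
      rw [← hBstar i j, ← star_ofNat (R := 𝕜) 2, ← star_div₀, ← hst, star_mul, star_star]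
    have hpair (i j x y : Fin n) :
        (Pi.single i (s i j) + Pi.single j (t i j) : Fin n → 𝕜) x *
          star ((Pi.single i (s i j) + Pi.single j (t i j) : Fin n → 𝕜) y) =
        (if x = i then if y = i then (‖B i j‖ : 𝕜) / 2 else 0 else 0) +
        (if x = j then if y = j then (‖B i j‖ : 𝕜) / 2 else 0 else 0) +
        (if x = i then if y = j then B i j / 2 else 0 else 0) +
        (if x = j then if y = i then B j i / 2 else 0 else 0) := by
      rw [← hst i j, ← hts i j]
      simp only [Pi.add_apply, Pi.single_apply, star_add]
      split_ifs <;> simp [-RCLike.star_def, add_mul, mul_add, hs, ht] <;> ring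
    have hsingle (i x y : Fin n) :
        (Pi.single i (d i) : Fin n → 𝕜) x * star ((Pi.single i (d i) : Fin n → 𝕜) y) =
        if x = i then if y = i then d i * star (d i) else 0 else 0 := by
      simp only [Pi.single_apply]
      split_ifs <;> simp
    ext x y
    simp only [Matrix.sum_apply, vecMulVec_apply, Pi.star_apply, Fintype.sum_sum_type,
      Sum.elim_inl, Sum.elim_inr, Fintype.sum_prod_type, hpair, hsingle, hd,
      Finset.sum_add_distrib]
    rw [Finset.sum_comm]
    simp only [Finset.sum_ite_irrel, Finset.sum_const_zero, Finset.sum_ite_eq, Finset.mem_univ,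
      if_true]
    by_cases h : y = x
    · subst h
      simp only [if_true, hBnorm _ y, hBdiag, ← Finset.sum_div, RCLike.ofReal_sum]
      ring
    · simp [h, hBoff h]
end

section
/- An n×n positive semidefinite matrix A over F (F = ℝ or ℂ) has factor width at most 2 if and only if A is scaled diagonally dominant, i.e., there exists a diagonal matrix D with strictly positive real diagonal entries such that DAD is diagonally dominant. -/
open Matrix
open scoped ComplexOrder

variable {𝕜 : Type*} [RCLike 𝕜] {n : ℕ}

/-- A symmetric copositive matrix with nonpositive off-diagonal entries maps some strictly positive
vector to a nonnegative one. -/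
theorem exists_pos_mulVec_nonneg_of_copositive :
    ∀ (m : ℕ) (M : Fin m → Fin m → ℝ), (∀ i j, M i j = M j i) → (∀ i j, i ≠ j → M i j ≤ 0) →
      (∀ x : Fin m → ℝ, (∀ i, 0 ≤ x i) → 0 ≤ ∑ i, ∑ j, M i j * (x i * x j)) →
      ∃ d : Fin m → ℝ, (∀ i, 0 < d i) ∧ ∀ i, 0 ≤ ∑ j, M i j * d j := by
  intro m
  induction m with
  | zero => exact fun M _ _ _ => ⟨fun _ => 1, fun i => i.elim0, fun i => i.elim0⟩
  | succ m ih =>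
    intro M hsymm hoff hcop
    have quad_cons : ∀ (t : ℝ) (x : Fin m → ℝ), 0 ≤ t → (∀ i, 0 ≤ x i) →
        0 ≤ M 0 0 * t ^ 2 + 2 * t * ∑ j, M 0 j.succ * x j +
          ∑ i, ∑ j : Fin m, M i.succ j.succ * (x i * x j) := by
      intro t x ht hx
      have h := hcop (Fin.cons t x) (Fin.cases (by simpa using ht) (by simpa using hx))
      simp only [Fin.sum_univ_succ, Fin.cons_zero, Fin.cons_succ, Finset.sum_add_distrib] at h
      have h1 : ∑ j : Fin m, M 0 j.succ * (t * x j) = t * ∑ j, M 0 j.succ * x j := by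
        rw [Finset.mul_sum]; exact Finset.sum_congr rfl fun j _ => by ring
      have h2 : ∑ j : Fin m, M j.succ 0 * (x j * t) = t * ∑ j, M 0 j.succ * x j := by
        rw [Finset.mul_sum]
        exact Finset.sum_congr rfl fun j _ => by rw [hsymm j.succ 0]; ring
      rw [h1, h2] at h
      linarith
    have hoff0 : ∀ j : Fin m, M 0 j.succ ≤ 0 := fun j => hoff _ _ (Fin.succ_ne_zero j).symm
    have h00 : 0 ≤ M 0 0 := by
      simpa using quad_cons 1 0 zero_le_one (fun _ => le_rfl)
    rcases h00.eq_or_lt with h00 | h00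
    · have hrow : ∀ j : Fin m, M 0 j.succ = 0 := by
        intro j
        by_contra hne
        have hlt : M 0 j.succ < 0 := lt_of_le_of_ne (hoff0 j) hne
        have key : ∀ t : ℝ, 0 ≤ t → 0 ≤ 2 * t * M 0 j.succ + M j.succ j.succ := by
          intro t ht
          have h := quad_cons t (Pi.single j 1) ht (fun i => by
            by_cases hij : i = j
            · subst hij; simp
            · simp [hij])
          simpa [← h00, Pi.single_apply] using h
        have hjj : 0 ≤ M j.succ j.succ := by simpa using key 0 le_rfl
        have h := key ((M j.succ j.succ + 1) / (-M 0 j.succ))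
          (div_nonneg (by linarith) (by linarith))
        have h' : (M j.succ j.succ + 1) / (-M 0 j.succ) * M 0 j.succ =
            -(M j.succ j.succ + 1) := by
          field_simp
        nlinarith
      obtain ⟨d, hd, hMd⟩ := ih (fun i j => M i.succ j.succ) (fun i j => hsymm _ _)
        (fun i j hij => hoff _ _ (fun h => hij (Fin.succ_injective _ h)))
        (fun x hx => by simpa using quad_cons 0 x le_rfl hx)
      refine ⟨Fin.cons 1 d, Fin.cases (by simp) (by simpa using hd), Fin.cases ?_ fun i => ?_⟩
      · simp [Fin.sum_univ_succ, hrow, ← h00]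
      · simpa [Fin.sum_univ_succ, hsymm i.succ 0, hrow] using hMd i
    · have schur_sum : ∀ (i : Fin m) (x : Fin m → ℝ),
          ∑ j : Fin m, (M i.succ j.succ - M 0 i.succ * M 0 j.succ / M 0 0) * x j =
            ∑ j : Fin m, M i.succ j.succ * x j -
              M 0 i.succ * ((∑ j, M 0 j.succ * x j) / M 0 0) := by
        intro i x
        rw [Finset.sum_div, Finset.mul_sum, ← Finset.sum_sub_distrib]
        exact Finset.sum_congr rfl fun j _ => by ring
      have hdot : ∀ x : Fin m → ℝ, (∀ i, 0 ≤ x i) → ∑ j, M 0 j.succ * x j ≤ 0 := fun x hx =>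
        Finset.sum_nonpos fun j _ => mul_nonpos_of_nonpos_of_nonneg (hoff0 j) (hx j)
      obtain ⟨d, hd, hMd⟩ := ih
        (fun i j => M i.succ j.succ - M 0 i.succ * M 0 j.succ / M 0 0)
        (fun i j => by simp only [hsymm i.succ j.succ, mul_comm])
        (fun i j hij => by
          have h1 := hoff i.succ j.succ (fun h => hij (Fin.succ_injective _ h))
          have h2 := div_nonneg (mul_nonneg_of_nonpos_of_nonpos (hoff0 i) (hoff0 j)) h00.le
          linarith)
        (fun x hx => by
          set s := ∑ j, M 0 j.succ * x j with hs
          have h := quad_cons (-s / M 0 0) x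
            (div_nonneg (by linarith [hdot x hx]) h00.le) hx
          have hrw : ∑ i : Fin m, ∑ j : Fin m,
              (M i.succ j.succ - M 0 i.succ * M 0 j.succ / M 0 0) * (x i * x j) =
              ∑ i : Fin m, ∑ j : Fin m, M i.succ j.succ * (x i * x j) - s * (s / M 0 0) := by
            calc _ = ∑ i : Fin m, (∑ j : Fin m, M i.succ j.succ * (x i * x j) -
                    M 0 i.succ * x i * (s / M 0 0)) := by
                  refine Finset.sum_congr rfl fun i _ => ?_
                  rw [hs, Finset.sum_div, Finset.mul_sum, ← Finset.sum_sub_distrib]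
                  exact Finset.sum_congr rfl fun j _ => by ring
              _ = _ := by rw [Finset.sum_sub_distrib, ← Finset.sum_mul]
          rw [hrw]
          rw [← hs] at h
          have : M 0 0 * (-s / M 0 0) ^ 2 + 2 * (-s / M 0 0) * s = -(s * (s / M 0 0)) := by
            field_simp; ring
          linarith)
      simp only [schur_sum] at hMd
      have hs := hdot d fun i => (hd i).le
      set s := ∑ j, M 0 j.succ * d j with hs_def
      rcases hs.eq_or_lt with hs0 | hs0
      · have hrow : ∀ j : Fin m, M 0 j.succ = 0 := by
          intro j
          have h := (Finset.sum_eq_zero_iff_of_nonpos (fun j _ =>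
            mul_nonpos_of_nonpos_of_nonneg (hoff0 j) (hd j).le)).1 hs0 j (Finset.mem_univ j)
          exact (mul_eq_zero.1 h).resolve_right (hd j).ne'
        refine ⟨Fin.cons 1 d, Fin.cases (by simp) (by simpa using hd), Fin.cases ?_ fun i => ?_⟩
        · simp [Fin.sum_univ_succ, hrow, h00.le]
        · simpa [Fin.sum_univ_succ, hsymm i.succ 0, hrow] using hMd i
      · refine ⟨Fin.cons (-s / M 0 0) d,
          Fin.cases (by simpa using div_pos (neg_pos.2 hs0) h00) (by simpa using hd),
          Fin.cases ?_ fun i => ?_⟩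
        · simp only [Fin.sum_univ_succ, Fin.cons_zero, Fin.cons_succ, ← hs_def]
          rw [mul_div_cancel₀ _ h00.ne']
          simp
        · have h := hMd i
          simp only [Fin.sum_univ_succ, Fin.cons_zero, Fin.cons_succ, hsymm i.succ 0]
          rw [neg_div]
          linarith

theorem factorWidthAtMost_vecMulVec {k : ℕ} (v : Fin n → 𝕜)
    (hv : ({i | v i ≠ 0} : Set (Fin n)).ncard ≤ k) :
    FactorWidthAtMost k (vecMulVec v (star v)) :=
  ⟨1, fun _ => v, fun _ => hv, by simp⟩

theorem FactorWidthAtMost.add {k : ℕ} {A B : Matrix (Fin n) (Fin n) 𝕜}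
    (hA : FactorWidthAtMost k A) (hB : FactorWidthAtMost k B) : FactorWidthAtMost k (A + B) := by
  obtain ⟨r, v, hv, rfl⟩ := hA
  obtain ⟨s, w, hw, rfl⟩ := hB
  refine ⟨r + s, Fin.append v w, fun j => ?_, by simp [Fin.sum_univ_add]⟩
  induction j using Fin.addCases with
  | left j => simpa using hv j
  | right j => simpa using hw j

theorem FactorWidthAtMost.sum {k : ℕ} {ι : Type*} (s : Finset ι)
    (B : ι → Matrix (Fin n) (Fin n) 𝕜) (hB : ∀ i ∈ s, FactorWidthAtMost k (B i)) :
    FactorWidthAtMost k (∑ i ∈ s, B i) :=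
  Finset.sum_induction B (FactorWidthAtMost k) (fun _ _ => FactorWidthAtMost.add)
    ⟨0, fun _ => 0, fun j => j.elim0, by simp⟩ hB

theorem factorWidthAtMost_single_diag {k : ℕ} (hk : 1 ≤ k) (i : Fin n) {c : ℝ} (hc : 0 ≤ c) :
    FactorWidthAtMost k (single i i (c : 𝕜)) := by
  have h : single i i (c : 𝕜) =
      vecMulVec (Pi.single i ((√c : ℝ) : 𝕜)) (star (Pi.single i ((√c : ℝ) : 𝕜))) := by
    ext p q
    have hs : ((√c : ℝ) : 𝕜) * ((√c : ℝ) : 𝕜) = (c : 𝕜) := by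
      rw [← RCLike.ofReal_mul, Real.mul_self_sqrt hc]
    rw [vecMulVec_apply, Pi.star_apply]
    by_cases hp : p = i
    · by_cases hq : q = i
      · simp [hp, hq, hs]
      · simp [hq, Ne.symm hq]
    · simp [hp, Ne.symm hp]
  rw [h]
  refine factorWidthAtMost_vecMulVec _ (le_trans ?_ hk)
  calc _ ≤ ({i} : Set (Fin n)).ncard := Set.ncard_le_ncard (fun p hp => by
        by_contra hne
        exact hp (by simp [show p ≠ i from hne])) (Set.toFinite _)
    _ = 1 := Set.ncard_singleton i

/-- A positive semidefinite matrix of rank at most one supported on two indices. -/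
theorem factorWidthAtMost_two_of_pair {i j : Fin n} (hij : i ≠ j) {a : 𝕜} {r s : ℝ} (hr : 0 ≤ r)
    (hs : 0 ≤ s) (hrs : r * s = ‖a‖ ^ 2) (hra : a = 0 → r = 0 ∧ s = 0) :
    FactorWidthAtMost 2
      (single i j a + single j i (star a) + single i i (r : 𝕜) + single j j (s : 𝕜)) := by
  by_cases ha : a = 0
  · obtain ⟨rfl, rfl⟩ := hra ha
    subst ha
    simpa using factorWidthAtMost_single_diag (𝕜 := 𝕜) one_le_two i le_rfl
  have hr' : 0 < r := hr.lt_of_ne (by rintro rfl; simp [eq_comm, ha] at hrs)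
  have hsq : ((√r : ℝ) : 𝕜) * ((√r : ℝ) : 𝕜) = (r : 𝕜) := by
    rw [← RCLike.ofReal_mul, Real.mul_self_sqrt hr]
  have hne : ((√r : ℝ) : 𝕜) ≠ 0 := by simpa using (Real.sqrt_pos.2 hr').ne'
  have hne' : (r : 𝕜) ≠ 0 := by simpa using hr'.ne'
  have hs' : star a / ((√r : ℝ) : 𝕜) * (a / ((√r : ℝ) : 𝕜)) = (s : 𝕜) := by
    rw [div_mul_div_comm, hsq, div_eq_iff hne', ← RCLike.ofReal_mul, mul_comm s r, hrs]
    simpa using RCLike.conj_mul a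
  let w : Fin n → 𝕜 := Pi.single i ((√r : ℝ) : 𝕜) + Pi.single j (star a / ((√r : ℝ) : 𝕜))
  have hw : single i j a + single j i (star a) + single i i (r : 𝕜) + single j j (s : 𝕜) =
      vecMulVec w (star w) := by
    have hwi : w i = ((√r : ℝ) : 𝕜) := by simp [w, hij]
    have hwj : w j = star a / ((√r : ℝ) : 𝕜) := by simp [w, hij.symm]
    have hw0 : ∀ p, p ≠ i → p ≠ j → w p = 0 := fun p h1 h2 => by simp [w, h1, h2]
    have hstar : star (w j) = a / ((√r : ℝ) : 𝕜) := by simp [hwj]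
    ext p q
    rw [vecMulVec_apply, Pi.star_apply]
    by_cases hpi : p = i
    · subst hpi
      by_cases hqi : q = p
      · subst hqi
        simp [hwi, hsq, hij.symm]
      by_cases hqj : q = j
      · subst hqj
        rw [hstar, hwi, mul_div_cancel₀ _ hne]
        simp [hij, hij.symm]
      · simp [hw0 q hqi hqj, Ne.symm hqi, Ne.symm hqj]
    by_cases hpj : p = j
    · subst hpj
      by_cases hqi : q = i
      · subst hqi
        rw [hwj, hwi]
        simp [hij, hij.symm, hne]
      by_cases hqj : q = p
      · subst hqj
        rw [hstar, hwj, hs']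
        simp [hij]
      · simp [hw0 q hqi hqj, Ne.symm hqi, Ne.symm hqj]
    · simp [hw0 p hpi hpj, Ne.symm hpi, Ne.symm hpj]
  rw [hw]
  refine factorWidthAtMost_vecMulVec w ?_
  calc _ ≤ ({i, j} : Set (Fin n)).ncard := Set.ncard_le_ncard (fun p hp => by
        by_contra hne
        simp only [Set.mem_insert_iff, Set.mem_singleton_iff, not_or] at hne
        exact hp (by simp [w, hne.1, hne.2])) (Set.toFinite _)
    _ ≤ 2 := (Set.ncard_insert_le _ _).trans (by simp)

theorem sum_offDiag_le_sum_sq_of_ncard_support_le_two (u : Fin n → ℝ)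
    (hu : ({i | u i ≠ 0} : Set (Fin n)).ncard ≤ 2) :
    ∑ i, ∑ j ∈ Finset.univ.erase i, u i * u j ≤ ∑ i, u i ^ 2 := by
  classical
  have hcard : (Finset.univ.filter fun i => u i ≠ 0).card ≤ 2 := by
    rwa [← Set.ncard_coe_finset, Finset.coe_filter_univ]
  have h := sq_sum_le_card_mul_sum_sq (s := Finset.univ.filter fun i => u i ≠ 0) (f := u)
  rw [Finset.sum_filter_ne_zero] at h
  have h2 : ∑ i ∈ Finset.univ.filter (fun i => u i ≠ 0), u i ^ 2 ≤ ∑ i, u i ^ 2 :=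
    Finset.sum_le_sum_of_subset_of_nonneg (Finset.filter_subset _ _) fun i _ _ => sq_nonneg _
  have h3 : ∑ i, ∑ j ∈ Finset.univ.erase i, u i * u j = (∑ i, u i) ^ 2 - ∑ i, u i ^ 2 := by
    rw [sq, Finset.sum_mul, ← Finset.sum_sub_distrib]
    refine Finset.sum_congr rfl fun i _ => ?_
    rw [Finset.mul_sum, ← Finset.add_sum_erase _ _ (Finset.mem_univ i)]
    ring
  have h4 : ((Finset.univ.filter fun i => u i ≠ 0).card : ℝ) ≤ 2 := by exact_mod_cast hcard
  have h5 : 0 ≤ ∑ i ∈ Finset.univ.filter (fun i => u i ≠ 0), u i ^ 2 :=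
    Finset.sum_nonneg fun i _ => sq_nonneg _
  nlinarith

theorem FactorWidthAtMost.sum_offDiag_norm_le {A : Matrix (Fin n) (Fin n) 𝕜}
    (hA : FactorWidthAtMost 2 A) {x : Fin n → ℝ} (hx : ∀ i, 0 ≤ x i) :
    ∑ i, ∑ j ∈ Finset.univ.erase i, ‖A i j‖ * (x i * x j) ≤ ∑ i, ‖A i i‖ * x i ^ 2 := by
  obtain ⟨r, v, hv, rfl⟩ := hA
  have hentry : ∀ i j, (∑ k, vecMulVec (v k) (star (v k))) i j = ∑ k, v k i * star (v k j) := by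
    intro i j
    simp [Matrix.sum_apply, vecMulVec_apply]
  have hdiag : ∀ i, ‖(∑ k, vecMulVec (v k) (star (v k))) i i‖ = ∑ k, ‖v k i‖ ^ 2 := by
    intro i
    have : ∑ k, v k i * star (v k i) = ((∑ k, ‖v k i‖ ^ 2 : ℝ) : 𝕜) := by
      push_cast
      exact Finset.sum_congr rfl fun k _ => RCLike.mul_conj _
    rw [hentry, this, RCLike.norm_of_nonneg (Finset.sum_nonneg fun k _ => sq_nonneg _)]
  have hoff : ∀ i j, ‖(∑ k, vecMulVec (v k) (star (v k))) i j‖ ≤ ∑ k, ‖v k i‖ * ‖v k j‖ := by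
    intro i j
    rw [hentry]
    exact (norm_sum_le _ _).trans_eq (Finset.sum_congr rfl fun k _ => by rw [norm_mul, norm_star])
  calc _ ≤ ∑ i, ∑ j ∈ Finset.univ.erase i, ∑ k, (‖v k i‖ * x i) * (‖v k j‖ * x j) := by
        refine Finset.sum_le_sum fun i _ => Finset.sum_le_sum fun j _ => ?_
        refine (mul_le_mul_of_nonneg_right (hoff i j) (mul_nonneg (hx i) (hx j))).trans_eq ?_
        rw [Finset.sum_mul]
        exact Finset.sum_congr rfl fun k _ => by ring
    _ = ∑ k, ∑ i, ∑ j ∈ Finset.univ.erase i, (‖v k i‖ * x i) * (‖v k j‖ * x j) := by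
        rw [Finset.sum_comm]
        exact Finset.sum_congr rfl fun i _ => Finset.sum_comm
    _ ≤ ∑ k, ∑ i, (‖v k i‖ * x i) ^ 2 := by
        refine Finset.sum_le_sum fun k _ =>
          sum_offDiag_le_sum_sq_of_ncard_support_le_two (fun i => ‖v k i‖ * x i) ?_
        refine (Set.ncard_le_ncard (fun i hi => ?_) (Set.toFinite _)).trans (hv k)
        intro h0
        exact hi (by simp [h0])
    _ = _ := by
        rw [Finset.sum_comm]
        refine Finset.sum_congr rfl fun i _ => ?_
        rw [hdiag, Finset.sum_mul]
        exact Finset.sum_congr rfl fun k _ => by ring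

theorem FactorWidthAtMost.exists_pos_sum_offDiag_le {A : Matrix (Fin n) (Fin n) 𝕜}
    (hH : A.IsHermitian) (hA : FactorWidthAtMost 2 A) :
    ∃ d : Fin n → ℝ, (∀ i, 0 < d i) ∧
      ∀ i, ∑ j ∈ Finset.univ.erase i, ‖A i j‖ * d j ≤ ‖A i i‖ * d i := by
  have split : ∀ (i : Fin n) (y : Fin n → ℝ),
      ∑ j, (if i = j then ‖A i j‖ else -‖A i j‖) * y j =
        ‖A i i‖ * y i - ∑ j ∈ Finset.univ.erase i, ‖A i j‖ * y j := by
    intro i y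
    rw [← Finset.add_sum_erase _ _ (Finset.mem_univ i), if_pos rfl, sub_eq_add_neg,
      ← Finset.sum_neg_distrib]
    congr 1
    refine Finset.sum_congr rfl fun j hj => ?_
    rw [if_neg (Finset.ne_of_mem_erase hj).symm, neg_mul]
  obtain ⟨d, hd, h⟩ := exists_pos_mulVec_nonneg_of_copositive n
    (fun i j => if i = j then ‖A i j‖ else -‖A i j‖)
    (fun i j => by
      have : ‖A i j‖ = ‖A j i‖ := by rw [← hH.apply i j, norm_star]
      simp only [this, eq_comm])
    (fun i j hij => by simp [hij])
    (fun x hx => by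
      simp only [split, Finset.sum_sub_distrib, ← sq]
      exact sub_nonneg.2 (hA.sum_offDiag_norm_le hx))
  refine ⟨d, hd, fun i => ?_⟩
  have := h i
  rw [split] at this
  linarith

theorem factorWidthAtMost_two_of_sum_offDiag_le {A : Matrix (Fin n) (Fin n) 𝕜}
    (hA : A.PosSemidef) {d : Fin n → ℝ} (hd : ∀ i, 0 < d i)
    (h : ∀ i, ∑ j ∈ Finset.univ.erase i, ‖A i j‖ * d j ≤ ‖A i i‖ * d i) :
    FactorWidthAtMost 2 A := by
  let a : Fin n → Fin n → 𝕜 := fun i j => if i = j then 0 else A i j / 2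
  let r : Fin n → Fin n → ℝ := fun i j => ‖a i j‖ * d j / d i
  have ha : ∀ i j, star (a i j) = a j i := by
    intro i j
    by_cases hij : i = j
    · simp [a, hij]
    · have := hA.isHermitian.apply j i
      simp only [a, if_neg hij, if_neg (Ne.symm hij), ← this]
      simp
  have hr : ∀ i j, 0 ≤ r i j := fun i j =>
    div_nonneg (mul_nonneg (norm_nonneg _) (hd j).le) (hd i).le
  have hpair : ∀ i j, FactorWidthAtMost 2 (single i j (a i j) + single j i (a j i) +
      single i i (r i j : 𝕜) + single j j (r j i : 𝕜)) := by
    intro i j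
    by_cases hij : i = j
    · subst hij
      simpa [r, a] using factorWidthAtMost_single_diag (𝕜 := 𝕜) one_le_two i le_rfl
    · rw [← ha i j]
      have hnorm : ‖a j i‖ = ‖a i j‖ := by rw [← ha i j, norm_star]
      refine factorWidthAtMost_two_of_pair hij (hr i j) (hr j i) ?_ ?_
      · have hi := (hd i).ne'
        have hj := (hd j).ne'
        simp only [r, hnorm]
        field_simp
      · intro h0
        simp [r, hnorm, h0]
  have hdiag : ∀ i, 0 ≤ ‖A i i‖ - 2 * ∑ j, r i j := by
    intro i
    have : 2 * ∑ j, r i j = (∑ j ∈ Finset.univ.erase i, ‖A i j‖ * d j) / d i := by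
      rw [← Finset.add_sum_erase _ _ (Finset.mem_univ i), Finset.sum_div]
      simp only [r, a, if_true, norm_zero, zero_mul, zero_div, zero_add, Finset.mul_sum]
      refine Finset.sum_congr rfl fun j hj => ?_
      rw [if_neg (Finset.ne_of_mem_erase hj).symm, norm_div, RCLike.norm_ofNat]
      ring
    rw [this, sub_nonneg, div_le_iff₀ (hd i)]
    exact h i
  have hsum : A = ∑ i, ∑ j, (single i j (a i j) + single j i (a j i) +
      single i i (r i j : 𝕜) + single j j (r j i : 𝕜)) +
      ∑ i, single i i ((‖A i i‖ - 2 * ∑ j, r i j : ℝ) : 𝕜) := by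
    have h1 : ∑ i, ∑ j, single j i (a j i) = ∑ i, ∑ j, single i j (a i j) := Finset.sum_comm
    have h2 : ∑ i, ∑ j, single j j (r j i : 𝕜) = ∑ i, ∑ j, single i i (r i j : 𝕜) :=
      Finset.sum_comm
    have h3 : ∑ i, ∑ j, single i j (a i j) = of a := (matrix_eq_sum_single (of a)).symm
    have h4 : ∑ i, ∑ j, single i i (r i j : 𝕜) = diagonal fun i => ((∑ j, r i j : ℝ) : 𝕜) := by
      rw [← sum_single_eq_diagonal]
      refine Finset.sum_congr rfl fun i _ => ?_
      rw [RCLike.ofReal_sum]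
      exact (map_sum (singleAddMonoidHom (α := 𝕜) i i) _ _).symm
    have h5 : ∑ i, single i i ((‖A i i‖ - 2 * ∑ j, r i j : ℝ) : 𝕜) =
        diagonal fun i => ((‖A i i‖ - 2 * ∑ j, r i j : ℝ) : 𝕜) :=
      sum_single_eq_diagonal _
    simp only [Finset.sum_add_distrib, h1, h2, h3, h4, h5]
    ext p q
    by_cases hpq : p = q
    · subst hpq
      have : ((‖A p p‖ : ℝ) : 𝕜) = A p p := RCLike.norm_of_nonneg' hA.diag_nonneg
      simp only [Matrix.add_apply, of_apply, diagonal_apply_eq, a, if_true, RCLike.ofReal_sub,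
        RCLike.ofReal_mul, RCLike.ofReal_ofNat, this]
      ring
    · simp [a, hpq]
  rw [hsum]
  exact (FactorWidthAtMost.sum _ _ fun i _ => FactorWidthAtMost.sum _ _ fun j _ => hpair i j).add
    (FactorWidthAtMost.sum _ _ fun i _ => factorWidthAtMost_single_diag one_le_two i (hdiag i))

theorem factorWidthAtMost_two_iff_scaledDiagDominant (A : Matrix (Fin n) (Fin n) 𝕜)
    (hA : A.PosSemidef) :
    FactorWidthAtMost 2 A ↔
      ∃ d : Fin n → ℝ, (∀ i, 0 < d i) ∧
        ∀ i, ∑ j ∈ Finset.univ.erase i,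
            ‖(Matrix.diagonal (fun i => (algebraMap ℝ 𝕜) (d i)) * A *
              Matrix.diagonal (fun i => (algebraMap ℝ 𝕜) (d i))) i j‖ ≤
          ‖(Matrix.diagonal (fun i => (algebraMap ℝ 𝕜) (d i)) * A *
              Matrix.diagonal (fun i => (algebraMap ℝ 𝕜) (d i))) i i‖ := by
  have hscale : ∀ d : Fin n → ℝ, (∀ i, 0 < d i) → ∀ i j,
      ‖(Matrix.diagonal (fun i => (algebraMap ℝ 𝕜) (d i)) * A *
        Matrix.diagonal (fun i => (algebraMap ℝ 𝕜) (d i))) i j‖ = d i * (‖A i j‖ * d j) := by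
    intro d hd i j
    rw [Matrix.mul_diagonal, Matrix.diagonal_mul, norm_mul, norm_mul, norm_algebraMap',
      norm_algebraMap', Real.norm_of_nonneg (hd i).le, Real.norm_of_nonneg (hd j).le, mul_assoc]
  have hiff : ∀ d : Fin n → ℝ, (∀ i, 0 < d i) → ∀ i,
      ((∑ j ∈ Finset.univ.erase i, d i * (‖A i j‖ * d j) ≤ d i * (‖A i i‖ * d i)) ↔
        ∑ j ∈ Finset.univ.erase i, ‖A i j‖ * d j ≤ ‖A i i‖ * d i) := fun d hd i => by
    rw [← Finset.mul_sum, mul_le_mul_iff_right₀ (hd i)]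
  constructor
  · intro h
    obtain ⟨d, hd, hdom⟩ := h.exists_pos_sum_offDiag_le hA.isHermitian
    refine ⟨d, hd, fun i => ?_⟩
    simp only [hscale d hd]
    exact (hiff d hd i).2 (hdom i)
  · rintro ⟨d, hd, hdom⟩
    simp only [hscale d hd] at hdom
    exact factorWidthAtMost_two_of_sum_offDiag_le hA hd fun i => (hiff d hd i).1 (hdom i)
end

section
/- Let n ≥ 3 and let A be an n×n positive semidefinite matrix over F (F = ℝ or ℂ) with factor width at most 2, such that for every index m there exist three distinct indices i, j, l with m ∈ {i, j, l} for which the 3×3 principal submatrix of A on rows and columns {i, j, l} has all nine entries nonzero. Then fran_2(A) = nnzu(A), the number of nonzero entries of A strictly above the main diagonal. -/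
open Matrix
open scoped ComplexOrder

variable {𝕜 : Type*} [RCLike 𝕜] {n : ℕ}

/-- The number of nonzero entries of `A` strictly above the main diagonal. -/
noncomputable def nnzu (A : Matrix (Fin n) (Fin n) 𝕜) : ℕ :=
  ({p : Fin n × Fin n | p.1 < p.2 ∧ A p.1 p.2 ≠ 0}).ncard


/-- Increasing the first row sum of a cyclic system on a triangle while keeping the other two
row sums fixed. -/
theorem exists_triangle_absorb {u v w p q r d : ℝ} (hu : 0 < u) (hv : 0 < v) (hw : 0 < w)
    (hp : 0 < p) (hq : 0 < q) (hr : 0 < r) (hd : 0 ≤ d) :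
    ∃ p' q' r' : ℝ, 0 < p' ∧ 0 < q' ∧ 0 < r' ∧ p' + w / r' = p + w / r + d ∧
      q' + u / p' = q + u / p ∧ r' + v / q' = r + v / q := by
  set Q : ℝ → ℝ := fun y => q + u / p - u / y with hQ
  set R : ℝ → ℝ := fun y => r + v / q - v / Q y with hR
  have hQq : ∀ y, p ≤ y → q ≤ Q y := fun y hy => by
    have : u / y ≤ u / p := by gcongr
    simp only [hQ]; linarith
  have hRr : ∀ y, p ≤ y → r ≤ R y := fun y hy => by
    have : v / Q y ≤ v / q := by
      have := hQq y hy
      gcongr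
    simp only [hR]; linarith
  set M := p + w / r + d
  have hwr : 0 < w / r := by positivity
  have hpM : p ≤ M := by linarith
  have hcont : ContinuousOn (fun y => y + w / R y) (Set.Icc p M) := by
    have hQc : ContinuousOn Q (Set.Icc p M) :=
      continuousOn_const.sub (continuousOn_const.div continuousOn_id
        fun y hy => (hp.trans_le hy.1).ne')
    have hRc : ContinuousOn R (Set.Icc p M) :=
      continuousOn_const.sub (continuousOn_const.div hQc
        fun y hy => (hq.trans_le (hQq y hy.1)).ne')
    exact continuousOn_id.add (continuousOn_const.div hRc
      fun y hy => (hr.trans_le (hRr y hy.1)).ne')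
  have hRp : R p = r := by simp [hR, hQ]
  have hRM : 0 < w / R M := div_pos hw (hr.trans_le (hRr M hpM))
  obtain ⟨y, hy, hyM⟩ := intermediate_value_Icc hpM hcont
    (show M ∈ Set.Icc (p + w / R p) (M + w / R M) from
      ⟨by rw [hRp]; linarith, by linarith⟩)
  refine ⟨y, Q y, R y, hp.trans_le hy.1, hq.trans_le (hQq y hy.1), hr.trans_le (hRr y hy.1),
    hyM, ?_, ?_⟩
  · simp only [hQ]; ring
  · simp only [hR]; ring

/-- Positive weights on the ordered pairs of adjacent vertices, the product of the two weights of
an edge being the prescribed number `W i j`. -/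
structure IsEdgeSplitting (W x : Matrix (Fin n) (Fin n) ℝ) : Prop where
  diag : ∀ i, x i i = 0
  pos : ∀ i j, i ≠ j → W i j ≠ 0 → 0 < x i j
  zero : ∀ i j, W i j = 0 → x i j = 0
  mul : ∀ i j, i ≠ j → x i j * x j i = W i j

theorem IsEdgeSplitting.exists_update {W x : Matrix (Fin n) (Fin n) ℝ}
    (hx : IsEdgeSplitting W x) (hW : ∀ i j, W i j = W j i) {i j : Fin n} (hij : i ≠ j)
    (hWij : 0 < W i j) {c : ℝ} (hc : 0 < c) :
    ∃ x', IsEdgeSplitting W x' ∧ x' i j = c ∧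
      (∀ a b, ¬(a = i ∧ b = j) → ¬(a = j ∧ b = i) → x' a b = x a b) ∧
      ∀ a, ∑ b, x' a b = ∑ b, x a b + (if a = i then c - x i j else 0) +
        (if a = j then W i j / c - x j i else 0) := by
  have hWc : 0 < W i j / c := by positivity
  refine ⟨fun a b => if a = i ∧ b = j then c else if a = j ∧ b = i then W i j / c else x a b,
    ⟨?_, ?_, ?_, ?_⟩, ?_, ?_, ?_⟩
  · intro a
    have := hx.diag a
    grind
  · intro a b hab hWab
    have := hx.pos a b hab hWab
    grind
  · intro a b hWab
    have := hx.zero a b hWab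
    have := hW i j
    grind
  · intro a b hab
    have := hx.mul a b hab
    have := hW i j
    have hc' : c * (W i j / c) = W i j := by field_simp
    have hc'' : W i j / c * c = W i j := by field_simp
    grind
  · simp
  · grind
  · intro a
    have key : ∀ b, (if a = i ∧ b = j then c else if a = j ∧ b = i then W i j / c else x a b) =
        x a b + (if b = j then if a = i then c - x i j else 0 else 0) +
          (if b = i then if a = j then W i j / c - x j i else 0 else 0) := by
      intro b
      grind
    simp only [key, Finset.sum_add_distrib, Finset.sum_ite_eq', Finset.mem_univ, if_true]

theorem IsEdgeSplitting.exists_absorb {W x : Matrix (Fin n) (Fin n) ℝ}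
    (hx : IsEdgeSplitting W x) (hW : ∀ i j, W i j = W j i) {i j l : Fin n} (hij : i ≠ j)
    (hil : i ≠ l) (hjl : j ≠ l) (hWij : 0 < W i j) (hWjl : 0 < W j l) (hWli : 0 < W l i)
    {d : ℝ} (hd : 0 ≤ d) :
    ∃ x', IsEdgeSplitting W x' ∧
      ∀ a, ∑ b, x' a b = ∑ b, x a b + if a = i then d else 0 := by
  have p0 := hx.pos i j hij hWij.ne'
  have q0 := hx.pos j l hjl hWjl.ne'
  have r0 := hx.pos l i hil.symm hWli.ne'
  obtain ⟨p, q, r, hp, hq, hr, h1, h2, h3⟩ := exists_triangle_absorb hWij hWjl hWli p0 q0 r0 hd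
  have e1 : W i j / x i j = x j i := by rw [← hx.mul i j hij]; field_simp
  have e2 : W j l / x j l = x l j := by rw [← hx.mul j l hjl]; field_simp
  have e3 : W l i / x l i = x i l := by rw [← hx.mul l i hil.symm]; field_simp
  rw [e1] at h2
  rw [e2] at h3
  rw [e3] at h1
  obtain ⟨x1, hx1, -, k1, s1⟩ := hx.exists_update hW hij hWij hp
  obtain ⟨x2, hx2, -, k2, s2⟩ := hx1.exists_update hW hjl hWjl hq
  obtain ⟨x3, hx3, -, k3, s3⟩ := hx2.exists_update hW hil.symm hWli hr
  refine ⟨x3, hx3, fun a => ?_⟩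
  rw [s3, s2, s1, k2 l i (by grind) (by grind), k2 i l (by grind) (by grind),
    k1 l i (by grind) (by grind), k1 i l (by grind) (by grind),
    k1 j l (by grind) (by grind), k1 l j (by grind) (by grind)]
  grind

theorem IsEdgeSplitting.exists_sum_eq {W x : Matrix (Fin n) (Fin n) ℝ}
    (hx : IsEdgeSplitting W x) (hW : ∀ i j, W i j = W j i) {s : Fin n → ℝ}
    (hs : ∀ i, ∑ j, x i j ≤ s i)
    (htri : ∀ i, ∃ j l, i ≠ j ∧ i ≠ l ∧ j ≠ l ∧ 0 < W i j ∧ 0 < W j l ∧ 0 < W l i) :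
    ∃ x', IsEdgeSplitting W x' ∧ ∀ i, ∑ j, x' i j = s i := by
  suffices h : ∀ S : Finset (Fin n), ∃ x', IsEdgeSplitting W x' ∧
      (∀ i, ∑ j, x' i j ≤ s i) ∧ ∀ i ∈ S, ∑ j, x' i j = s i by
    obtain ⟨x', h1, -, h2⟩ := h Finset.univ
    exact ⟨x', h1, fun i => h2 i (Finset.mem_univ i)⟩
  intro S
  induction S using Finset.induction_on with
  | empty => exact ⟨x, hx, hs, by simp⟩
  | insert i S _ ih =>
    obtain ⟨y, hy, hys, hyS⟩ := ih
    obtain ⟨j, l, hij, hil, hjl, h1, h2, h3⟩ := htri i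
    obtain ⟨z, hz, hzs⟩ := hy.exists_absorb hW hij hil hjl h1 h2 h3 (sub_nonneg.2 (hys i))
    refine ⟨z, hz, fun a => ?_, fun a ha => ?_⟩
    · have := hys a
      rw [hzs]
      split_ifs with h
      · subst h; linarith
      · linarith
    · rw [hzs]
      split_ifs with h
      · subst h; ring
      · rw [add_zero]
        exact hyS a (Finset.mem_of_mem_insert_of_ne ha h)

theorem eq_or_eq_of_ncard_le_two {α : Type*} [Finite α] {s : Set α} (hs : s.ncard ≤ 2) {a b c : α}
    (ha : a ∈ s) (hb : b ∈ s) (hc : c ∈ s) (hab : a ≠ b) : c = a ∨ c = b := by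
  by_contra! h
  have h3 : ({c, a, b} : Set α).ncard = 3 := Set.ncard_eq_three.2 ⟨c, a, b, h.1, h.2, hab, rfl⟩
  have : ({c, a, b} : Set α).ncard ≤ s.ncard :=
    Set.ncard_le_ncard (by rintro x (rfl | rfl | rfl) <;> assumption)
  omega

theorem sum_vecMulVec_star_apply {ι : Type*} [Fintype ι] (v : ι → Fin n → 𝕜) (i j : Fin n) :
    (∑ t, vecMulVec (v t) (star (v t))) i j = ∑ t, v t i * star (v t j) := by
  simp [Matrix.sum_apply, vecMulVec_apply]

theorem HasFWDecomp.nnzu_le {r : ℕ} {A : Matrix (Fin n) (Fin n) 𝕜} (h : HasFWDecomp 2 r A) :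
    nnzu A ≤ r := by
  obtain ⟨v, hv, rfl⟩ := h
  have key : ∀ p : {p : Fin n × Fin n | p.1 < p.2 ∧
      (∑ t, vecMulVec (v t) (star (v t))) p.1 p.2 ≠ 0},
      ∃ t, v t p.1.1 ≠ 0 ∧ v t p.1.2 ≠ 0 := by
    rintro ⟨⟨i, j⟩, hij, hne⟩
    rw [sum_vecMulVec_star_apply] at hne
    obtain ⟨t, -, ht⟩ := Finset.exists_ne_zero_of_sum_ne_zero hne
    exact ⟨t, left_ne_zero_of_mul ht, star_ne_zero.1 (right_ne_zero_of_mul ht)⟩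
  choose f hf using key
  have hinj : Function.Injective f := by
    rintro ⟨⟨i, j⟩, hij, hne⟩ ⟨⟨k, l⟩, hkl, hne'⟩ heq
    have h1 := hf ⟨⟨i, j⟩, hij, hne⟩
    have h2 := hf ⟨⟨k, l⟩, hkl, hne'⟩
    rw [← heq] at h2
    have hs := hv (f ⟨⟨i, j⟩, hij, hne⟩)
    have hk := eq_or_eq_of_ncard_le_two hs h1.1 h1.2 h2.1 hij.ne
    have hl := eq_or_eq_of_ncard_le_two hs h1.1 h1.2 h2.2 hij.ne
    simp only [Subtype.mk.injEq, Prod.mk.injEq]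
    simp only at hij hkl hk hl
    grind
  have := Nat.card_le_card_of_injective f hinj
  rwa [Nat.card_coe_set_eq, Nat.card_fin] at this

theorem HasFWDecomp.exists_isEdgeSplitting {r : ℕ} {A : Matrix (Fin n) (Fin n) 𝕜}
    (h : HasFWDecomp 2 r A) :
    ∃ x, IsEdgeSplitting (of fun i j => ‖A i j‖ ^ 2) x ∧ ∀ i, ∑ j, x i j ≤ RCLike.re (A i i) := by
  obtain ⟨v, hv, hA⟩ := h
  set y : Fin n → Fin n → ℝ := fun i j => ∑ t, if v t j = 0 then 0 else ‖v t i‖ ^ 2 with hy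
  have hy0 : ∀ i j, 0 ≤ y i j := fun i j => Finset.sum_nonneg fun t _ => by split_ifs <;> positivity
  have hAy : ∀ i j, ‖A i j‖ ≤ √(y i j) * √(y j i) := by
    intro i j
    rw [hA, sum_vecMulVec_star_apply]
    calc ‖∑ t, v t i * star (v t j)‖
        ≤ ∑ t, (if v t j = 0 then 0 else ‖v t i‖) * (if v t i = 0 then 0 else ‖v t j‖) := by
          refine (norm_sum_le _ _).trans (Finset.sum_le_sum fun t _ => ?_)
          rw [norm_mul, norm_star]
          split_ifs <;> simp_all
      _ ≤ _ := by
          refine (Real.sum_mul_le_sqrt_mul_sqrt _ _ _).trans_eq ?_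
          simp [hy, ite_pow]
  have hypos : ∀ i j, A i j ≠ 0 → 0 < √(y i j) ∧ 0 < √(y j i) := by
    intro i j hij
    have h1 := (norm_pos_iff.2 hij).trans_le (hAy i j)
    have h2 := Real.sqrt_nonneg (y i j)
    have h3 := Real.sqrt_nonneg (y j i)
    exact ⟨pos_of_mul_pos_left h1 h3, pos_of_mul_pos_right h1 h2⟩
  have hAsymm : ∀ i j, ‖A i j‖ = ‖A j i‖ := by
    intro i j
    rw [hA, sum_vecMulVec_star_apply, sum_vecMulVec_star_apply, ← norm_star, star_sum]
    simp [mul_comm]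
  refine ⟨of fun i j => if i = j then 0 else ‖A i j‖ * (√(y i j) / √(y j i)),
    ⟨?_, ?_, ?_, ?_⟩, ?_⟩
  · simp
  · intro i j hij hW
    have hne : A i j ≠ 0 := by simpa using hW
    obtain ⟨h1, h2⟩ := hypos i j hne
    have := norm_pos_iff.2 hne
    simp only [of_apply, if_neg hij]
    positivity
  · intro i j hW
    have hne : A i j = 0 := by simpa using hW
    simp [hne]
  · intro i j hij
    simp only [of_apply, if_neg hij, if_neg hij.symm, ← hAsymm i j]
    by_cases hne : A i j = 0
    · simp [hne]
    · obtain ⟨h1, h2⟩ := hypos i j hne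
      field_simp
  · intro i
    have hle : ∀ j, (of fun i j => if i = j then 0 else ‖A i j‖ * (√(y i j) / √(y j i))) i j ≤
        if i = j then 0 else y i j := by
      intro j
      simp only [of_apply]
      split_ifs with hij
      · rfl
      by_cases hne : A i j = 0
      · simp [hne, hy0]
      obtain ⟨h1, h2⟩ := hypos i j hne
      calc _ ≤ √(y i j) * √(y j i) * (√(y i j) / √(y j i)) := by
            gcongr
            exact hAy i j
        _ = √(y i j) * √(y i j) := by field_simp
        _ = y i j := Real.mul_self_sqrt (hy0 i j)
    refine (Finset.sum_le_sum fun j _ => hle j).trans ?_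
    have hAii : RCLike.re (A i i) = ∑ t, ‖v t i‖ ^ 2 := by
      rw [hA, sum_vecMulVec_star_apply, map_sum]
      refine Finset.sum_congr rfl fun t _ => ?_
      rw [RCLike.star_def, RCLike.mul_conj, ← RCLike.ofReal_pow, RCLike.ofReal_re]
    rw [hAii]
    calc ∑ j, (if i = j then 0 else y i j)
        = ∑ t, ∑ j, if i = j ∨ v t j = 0 then 0 else ‖v t i‖ ^ 2 := by
          rw [Finset.sum_comm]
          refine Finset.sum_congr rfl fun j _ => ?_
          by_cases hij : i = j <;> simp [hij, hy]
      _ ≤ _ := by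
          refine Finset.sum_le_sum fun t _ => ?_
          by_cases hti : v t i = 0
          · simp [hti]
          by_cases hex : ∃ k, i ≠ k ∧ v t k ≠ 0
          · obtain ⟨k, hik, htk⟩ := hex
            rw [Finset.sum_eq_single k]
            · simp [hik, htk]
            · intro j _ hjk
              rw [if_pos]
              by_contra! hj
              rcases eq_or_eq_of_ncard_le_two (hv t) hti htk hj.2 hik with rfl | rfl
              · exact hj.1 rfl
              · exact hjk rfl
            · simp
          · push Not at hex
            rw [Finset.sum_eq_zero]
            · positivity
            · intro j _
              rw [if_pos]
              by_cases hij : i = j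
              · exact .inl hij
              · exact .inr (hex j hij)

theorem vecMulVec_single_single {α ι κ : Type*} [DecidableEq ι] [DecidableEq κ] [MulZeroClass α]
    (i : ι) (j : κ) (c d : α) :
    vecMulVec (Pi.single i c) (Pi.single j d) = Matrix.single i j (c * d) := by
  ext a b
  simp only [vecMulVec_apply, Pi.single_apply, Matrix.single_apply, eq_comm (a := i),
    eq_comm (a := j)]
  split_ifs <;> simp_all

theorem hasFWDecomp_nnzu_of_isEdgeSplitting {A : Matrix (Fin n) (Fin n) 𝕜} (hA : A.IsHermitian)
    {x : Matrix (Fin n) (Fin n) ℝ} (hx : IsEdgeSplitting (of fun i j => ‖A i j‖ ^ 2) x)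
    (hsum : ∀ i, ∑ j, x i j = RCLike.re (A i i)) : HasFWDecomp 2 (nnzu A) A := by
  classical
  set E : Set (Fin n × Fin n) := {p | p.1 < p.2 ∧ A p.1 p.2 ≠ 0}
  have hcard : Fintype.card E = nnzu A := by
    rw [← Nat.card_eq_fintype_card, Nat.card_coe_set_eq]; rfl
  let e : Fin (nnzu A) ≃ E := (Fintype.equivFinOfCardEq hcard).symm
  let u : Fin n × Fin n → Fin n → 𝕜 := fun p =>
    Pi.single p.1 ((√(x p.1 p.2) : ℝ) : 𝕜) + Pi.single p.2 (A p.2 p.1 / ((√(x p.1 p.2) : ℝ) : 𝕜))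
  let N : Fin n → Fin n → Matrix (Fin n) (Fin n) 𝕜 := fun i j =>
    Matrix.single i i ((x i j : ℝ) : 𝕜) + Matrix.single i j (A i j)
  have hN : ∀ i j, A i j = 0 → N i j = 0 := by
    intro i j hij
    have : x i j = 0 := hx.zero i j (by simp [hij])
    simp [N, hij, this]
  have hA' : ∀ i j, star (A i j) = A j i := fun i j => hA.apply j i
  have hu : ∀ p ∈ E, vecMulVec (u p) (star (u p)) = N p.1 p.2 + N p.2 p.1 := by
    rintro ⟨i, j⟩ ⟨hij, hne⟩
    simp only at hij hne
    have hW : (of fun i j => ‖A i j‖ ^ 2) i j ≠ 0 := by simpa using hne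
    have hpos := hx.pos i j hij.ne hW
    have hmul : x i j * x j i = ‖A i j‖ ^ 2 := hx.mul i j hij.ne
    have hs : (((√(x i j) : ℝ)) : 𝕜) * ((√(x i j) : ℝ) : 𝕜) = (x i j : 𝕜) := by
      rw [← RCLike.ofReal_mul, Real.mul_self_sqrt hpos.le]
    have hs0 : ((√(x i j) : ℝ) : 𝕜) ≠ 0 := by
      simpa using (Real.sqrt_pos.2 hpos).ne'
    have hx0 : ((x i j : ℝ) : 𝕜) ≠ 0 := by simpa using hpos.ne'
    have hji : A j i * A i j = (x i j : 𝕜) * (x j i : 𝕜) := by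
      rw [← hA' i j, RCLike.star_def, RCLike.conj_mul, ← RCLike.ofReal_mul, hmul,
        RCLike.ofReal_pow]
    have hstar : star (u (i, j)) = Pi.single i ((√(x i j) : ℝ) : 𝕜) +
        Pi.single j (A i j / ((√(x i j) : ℝ) : 𝕜)) := by
      simp only [u, star_add, ← Pi.single_star, star_div₀, hA']
      simp [RCLike.star_def]
    have hjj : A j i / ((√(x i j) : ℝ) : 𝕜) * (A i j / ((√(x i j) : ℝ) : 𝕜)) = (x j i : 𝕜) := by
      rw [div_mul_div_comm, hs, hji, mul_div_cancel_left₀ _ hx0]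
    rw [hstar]
    simp only [u, vecMulVec_add, add_vecMulVec, vecMulVec_single_single, N]
    rw [hs, hjj, mul_div_cancel₀ _ hs0, div_mul_cancel₀ _ hs0]
    abel
  refine ⟨fun t => u (e t), fun t => ?_, ?_⟩
  · calc _ ≤ ({(e t).1.1, (e t).1.2} : Set (Fin n)).ncard := by
          refine Set.ncard_le_ncard fun i hi => ?_
          by_contra! h
          simp only [Set.mem_insert_iff, Set.mem_singleton_iff, not_or] at h
          exact hi (by simp [u, h.1, h.2])
      _ ≤ 2 := by
          refine (Set.ncard_insert_le _ _).trans ?_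
          simp
  · have h1 : ∑ t, vecMulVec (u (e t)) (star (u (e t))) =
        ∑ i, ∑ j, if i < j then N i j + N j i else 0 := by
      rw [e.sum_comp (fun p : E => vecMulVec (u p) (star (u p))),
        ← Fintype.sum_prod_type' (f := fun i j => if i < j then N i j + N j i else 0),
        ← Finset.sum_subtype E.toFinset (fun _ => Set.mem_toFinset)
          (fun p => vecMulVec (u p) (star (u p))), Finset.sum_congr rfl
          fun p hp => hu p (Set.mem_toFinset.1 hp)]
      refine (Finset.sum_congr rfl fun p hp => ?_).trans
        (Finset.sum_subset (Finset.subset_univ _) fun p _ hp => ?_)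
      · rw [if_pos (Set.mem_toFinset.1 hp).1]
      · split_ifs with hlt
        · have h0 : A p.1 p.2 = 0 := by
            by_contra hne
            exact hp (Set.mem_toFinset.2 ⟨hlt, hne⟩)
          rw [hN _ _ h0, hN _ _ (by rw [← hA', h0, star_zero]), add_zero]
        · rfl
    have h2 : ∑ i, ∑ j, (if i < j then N i j + N j i else 0) =
        ∑ i, ∑ j, if i ≠ j then N i j else 0 := by
      have : ∀ i j, (if i ≠ j then N i j else 0) =
          (if i < j then N i j else 0) + (if j < i then N i j else 0) := by
        intro i j
        rcases lt_trichotomy i j with h | h | h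
        · simp [h, h.ne, h.not_gt]
        · simp [h]
        · simp [h, h.ne', h.not_gt]
      simp only [this, Finset.sum_add_distrib]
      rw [Finset.sum_comm (f := fun i j => if j < i then N i j else 0), ← Finset.sum_add_distrib]
      refine Finset.sum_congr rfl fun i _ => ?_
      rw [← Finset.sum_add_distrib]
      refine Finset.sum_congr rfl fun j _ => ?_
      split_ifs <;> simp
    rw [h1, h2]
    ext a b
    have h3 : ∀ i j, (if i ≠ j then N i j else 0) a b =
        (if a = i then if a = b then (x i j : 𝕜) else 0 else 0) +
        (if a = i then if b = j then if a = b then 0 else A a b else 0 else 0) := by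
      intro i j
      have := hx.diag i
      by_cases hij : i = j
      · subst hij
        simp only [ne_eq, not_true_eq_false, if_false, Matrix.zero_apply, this]
        grind
      · simp only [ne_eq, hij, not_false_eq_true, if_true, N, Matrix.add_apply, Matrix.single_apply]
        grind
    simp only [Matrix.sum_apply, h3]
    rw [Finset.sum_comm]
    simp only [Finset.sum_add_distrib, Finset.sum_ite_eq, Finset.mem_univ, if_true]
    by_cases hab : a = b
    · subst hab
      simp [← RCLike.ofReal_sum, hsum, hA.coe_re_apply_self]
    · simp [hab]

theorem fran_two_eq_nnzu (hn : 3 ≤ n) (A : Matrix (Fin n) (Fin n) 𝕜)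
    (hA : A.PosSemidef) (h2 : FactorWidthAtMost 2 A)
    (h3 : ∀ m : Fin n, ∃ i j l : Fin n, i ≠ j ∧ i ≠ l ∧ j ≠ l ∧
      (m = i ∨ m = j ∨ m = l) ∧
      ∀ a ∈ ({i, j, l} : Set (Fin n)), ∀ b ∈ ({i, j, l} : Set (Fin n)), A a b ≠ 0) :
    fran 2 A = nnzu A := by
  have hpos : ∀ i j, A i j ≠ 0 → 0 < (of fun i j => ‖A i j‖ ^ 2 : Matrix (Fin n) (Fin n) ℝ) i j :=
    fun i j hij => by
      have := norm_pos_iff.2 hij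
      simp only [of_apply]
      positivity
  have hsymm : ∀ i j, (of fun i j => ‖A i j‖ ^ 2 : Matrix (Fin n) (Fin n) ℝ) i j =
      (of fun i j => ‖A i j‖ ^ 2 : Matrix (Fin n) (Fin n) ℝ) j i := fun i j => by
    simp only [of_apply]
    rw [← hA.isHermitian.apply i j, norm_star]
  obtain ⟨r, hr⟩ := h2
  obtain ⟨x, hx, hxs⟩ := hr.exists_isEdgeSplitting
  obtain ⟨y, hy, hys⟩ := hx.exists_sum_eq hsymm hxs fun m => by
    obtain ⟨i, j, l, hij, hil, hjl, hm, hne⟩ := h3 m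
    simp only [Set.mem_insert_iff, Set.mem_singleton_iff, forall_eq_or_imp, forall_eq] at hne
    obtain ⟨⟨-, hAij, hAil⟩, ⟨hAji, -, hAjl⟩, hAli, hAlj, -⟩ := hne
    rcases hm with rfl | rfl | rfl
    · exact ⟨j, l, hij, hil, hjl, hpos _ _ hAij, hpos _ _ hAjl, hpos _ _ hAli⟩
    · exact ⟨i, l, hij.symm, hjl, hil, hpos _ _ hAji, hpos _ _ hAil, hpos _ _ hAlj⟩
    · exact ⟨i, j, hil.symm, hjl.symm, hij, hpos _ _ hAli, hpos _ _ hAij, hpos _ _ hAjl⟩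
  have hmem := hasFWDecomp_nnzu_of_isEdgeSplitting hA.isHermitian hy hys
  exact le_antisymm (Nat.sInf_le hmem) (le_csInf ⟨_, hmem⟩ fun _ h => h.nnzu_le)
end

section
/- Let n ≥ 3 and let A be an n×n positive semidefinite matrix over F (F = ℝ or ℂ) with factor width at most 2 and with no entries equal to 0. Then fran_2(A) = n(n−1)/2. -/
open Matrix
open scoped ComplexOrder

variable {𝕜 : Type*} [RCLike 𝕜] {n : ℕ}

section Allocation

variable {ι : Type*} [Fintype ι]

/-- Nonnegative splittings `x i j` of the budgets `d i` among the other indices `j`, such that each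
product `x i j * x j i` is at least `m i j`. -/
def feasibleSplittings (m : ι → ι → ℝ) (d : ι → ℝ) : Set (ι → ι → ℝ) :=
  {x | (∀ i j, 0 ≤ x i j) ∧ (∀ i, x i i = 0) ∧ (∀ i j, i ≠ j → m i j ≤ x i j * x j i) ∧
    ∀ i, ∑ j, x i j ≤ d i}

lemma isCompact_feasibleSplittings (m : ι → ι → ℝ) (d : ι → ℝ) :
    IsCompact (feasibleSplittings m d) := by
  have hsub : feasibleSplittings m d ⊆ Set.Icc 0 (fun i _ => d i) := by
    rintro x ⟨h0, -, -, hs⟩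
    refine ⟨fun i j => h0 i j, fun i j => ?_⟩
    exact (Finset.single_le_sum (fun k _ => h0 i k) (Finset.mem_univ j)).trans (hs i)
  refine isCompact_Icc.of_isClosed_subset ?_ hsub
  simp only [feasibleSplittings, Set.ofPred_and, Set.ofPred_forall]
  refine IsClosed.inter ?_ (IsClosed.inter ?_ (IsClosed.inter ?_ ?_))
  · exact isClosed_iInter fun i => isClosed_iInter fun j =>
      isClosed_le (by fun_prop) (by fun_prop)
  · exact isClosed_iInter fun i => isClosed_eq (by fun_prop) (by fun_prop)
  · exact isClosed_iInter fun i => isClosed_iInter fun j => isClosed_iInter fun _ =>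
      isClosed_le (by fun_prop) (by fun_prop)
  · exact isClosed_iInter fun i => isClosed_le (by fun_prop) (by fun_prop)

lemma sum_add_bump [DecidableEq ι] (x : ι → ι → ℝ) (i j a : ι) (t : ℝ) :
    ∑ b, (x a b + if a = i ∧ b = j then t else 0) = ∑ b, x a b + if a = i then t else 0 := by
  by_cases h : a = i <;> simp [Finset.sum_add_distrib, h]

lemma feasibleSplittings_add_bump [DecidableEq ι] {m : ι → ι → ℝ} {d : ι → ℝ}
    (hm : ∀ i j, m i j = m j i) {x : ι → ι → ℝ} (hx : x ∈ feasibleSplittings m d)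
    {i j : ι} (hij : i ≠ j) {t : ℝ} (h0 : 0 ≤ x i j + t) (hp : m i j ≤ (x i j + t) * x j i)
    (hs : ∑ b, x i b + t ≤ d i) :
    (fun a b => x a b + if a = i ∧ b = j then t else 0) ∈ feasibleSplittings m d := by
  obtain ⟨hx0, hxd, hxp, hxs⟩ := hx
  refine ⟨fun a b => ?_, fun a => ?_, fun a b hab => ?_, fun a => ?_⟩
  · dsimp only
    split_ifs with h
    · obtain ⟨rfl, rfl⟩ := h
      exact h0
    · simpa using hx0 a b
  · have : ¬ (a = i ∧ a = j) := fun h => hij (h.1.symm.trans h.2)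
    simp [this, hxd a]
  · dsimp only
    by_cases h1 : a = i ∧ b = j
    · obtain ⟨rfl, rfl⟩ := h1
      simpa [hij, hij.symm] using hp
    by_cases h2 : b = i ∧ a = j
    · obtain ⟨rfl, rfl⟩ := h2
      rw [hm, mul_comm]
      simpa [hij, hij.symm] using hp
    · simpa [h1, h2] using hxp a b hab
  · dsimp only
    rw [sum_add_bump]
    split_ifs with h
    · subst h
      exact hs
    · simpa using hxs a

/-- A feasible splitting can be improved to one in which all constraints are equalities, provided
there is an orientation `i → σ i` without loops and without 2-cycles. -/
lemma exists_tight_splitting {m : ι → ι → ℝ} {d : ι → ℝ} (hm : ∀ i j, m i j = m j i)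
    (hpos : ∀ i j, 0 < m i j) (σ : ι → ι) (hσ : ∀ i, σ i ≠ i) (hσ2 : ∀ i, σ (σ i) ≠ i)
    (hne : (feasibleSplittings m d).Nonempty) :
    ∃ x : ι → ι → ℝ, (∀ i j, 0 ≤ x i j) ∧ (∀ i, x i i = 0) ∧
      (∀ i j, i ≠ j → x i j * x j i = m i j) ∧ ∀ i, ∑ j, x i j = d i := by
  classical
  obtain ⟨x, hx, hmax⟩ := (isCompact_feasibleSplittings m d).exists_isMaxOn hne
    (f := fun x => ∑ i, x i (σ i)) (by fun_prop)
  have hobj : ∀ (y : ι → ι → ℝ) (i j : ι) (t : ℝ),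
      ∑ a, (y a (σ a) + if a = i ∧ σ a = j then t else 0)
        = ∑ a, y a (σ a) + if σ i = j then t else 0 := by
    intro y i j t
    rw [Finset.sum_add_distrib]
    simp only [ite_and]
    simp
  have tight : ∀ y ∈ feasibleSplittings m d, ∑ i, y i (σ i) = ∑ i, x i (σ i) →
      ∀ i, ∑ j, y i j = d i := by
    intro y hy hyx i
    by_contra hlt
    have hlt := lt_of_le_of_ne (hy.2.2.2 i) hlt
    have hmem := feasibleSplittings_add_bump hm hy (hσ i).symm (t := d i - ∑ j, y i j)
      (by linarith [hy.1 i (σ i)])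
      ((hy.2.2.1 i (σ i) (hσ i).symm).trans
        (mul_le_mul_of_nonneg_right (by linarith) (hy.1 _ _))) (by linarith)
    have := hmax hmem
    simp only [Set.mem_ofPred_eq, hobj, if_true] at this
    linarith
  have key : ∀ i j, i ≠ j → σ i ≠ j → x i j * x j i = m i j := by
    intro i j hij hs
    have hge := hx.2.2.1 i j hij
    have hji : 0 < x j i := by
      refine lt_of_le_of_ne (hx.1 j i) fun h => ?_
      rw [← h, mul_zero] at hge
      exact (hpos i j).not_ge hge
    have hle : m i j / x j i ≤ x i j := (div_le_iff₀ hji).2 hge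
    have hmem := feasibleSplittings_add_bump hm hx hij (t := m i j / x j i - x i j)
      (by rw [add_sub_cancel]; exact (div_pos (hpos i j) hji).le)
      (by rw [add_sub_cancel, div_mul_cancel₀ _ hji.ne'])
      (by linarith [hx.2.2.2 i])
    have h1 := tight _ hmem (by rw [hobj]; simp [hs]) i
    have h2 := tight x hx rfl i
    rw [sum_add_bump, if_pos rfl] at h1
    rw [← div_mul_cancel₀ (m i j) hji.ne']
    congr 1
    linarith
  refine ⟨x, hx.1, hx.2.1, fun i j hij => ?_, tight x hx rfl⟩
  by_cases hs : σ i = j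
  · rw [hm, mul_comm]
    exact key j i hij.symm (by rw [← hs]; exact hσ2 i)
  · exact key i j hij hs

end Allocation

lemma card_lt_pairs (n : ℕ) :
    Fintype.card {p : Fin n × Fin n // p.1 < p.2} = n * (n - 1) / 2 := by
  rw [Fintype.card_subtype, Finset.card_filter, Fintype.sum_prod_type_right]
  simp only [← Finset.card_filter]
  have : ∀ j : Fin n, (Finset.univ.filter fun i => i < j).card = (j : ℕ) := fun j => by
    rw [Finset.filter_gt_eq_Iio, Fin.card_Iio]
  simp only [this]
  rw [Fin.sum_univ_eq_sum_range (fun i => i), Finset.sum_range_id]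

lemma le_of_hasFWDecomp_two {A : Matrix (Fin n) (Fin n) 𝕜} (hnz : ∀ i j, A i j ≠ 0) {r : ℕ}
    (h : HasFWDecomp 2 r A) : n * (n - 1) / 2 ≤ r := by
  obtain ⟨v, hv, rfl⟩ := h
  have hex : ∀ p : {p : Fin n × Fin n // p.1 < p.2}, ∃ k, v k p.1.1 ≠ 0 ∧ v k p.1.2 ≠ 0 := by
    intro p
    have := hnz p.1.1 p.1.2
    rw [Matrix.sum_apply] at this
    obtain ⟨k, -, hk⟩ := Finset.exists_ne_zero_of_sum_ne_zero this
    refine ⟨k, ?_⟩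
    simpa [Matrix.vecMulVec_apply] using hk
  choose f hf1 hf2 using hex
  have hinj : Function.Injective f := by
    rintro p q hpq
    have hsub : ({p.1.1, p.1.2} : Set (Fin n)) ⊆ {i | v (f p) i ≠ 0} := by
      rintro i (rfl | rfl)
      exacts [hf1 p, hf2 p]
    have heq := Set.eq_of_subset_of_ncard_le hsub
      ((hv (f p)).trans (Set.ncard_pair p.2.ne).ge)
    have h1 : q.1.1 ∈ ({p.1.1, p.1.2} : Set (Fin n)) := by
      rw [heq, hpq]
      exact hf1 q
    have h2 : q.1.2 ∈ ({p.1.1, p.1.2} : Set (Fin n)) := by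
      rw [heq, hpq]
      exact hf2 q
    have hp := p.2
    have hq := q.2
    simp only [Set.mem_insert_iff, Set.mem_singleton_iff] at h1 h2
    apply Subtype.ext
    apply Prod.ext <;> grind
  rw [← card_lt_pairs]
  simpa using Fintype.card_le_of_injective f hinj

lemma nonempty_feasibleSplittings_of_decomp {r : ℕ} (v : Fin r → Fin n → 𝕜)
    (hv : ∀ k, ({i | v k i ≠ 0} : Set (Fin n)).ncard ≤ 2) :
    (feasibleSplittings (fun i j => ‖∑ k, v k i * star (v k j)‖ ^ 2)
      (fun i => ∑ k, ‖v k i‖ ^ 2)).Nonempty := by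
  classical
  refine ⟨fun i j => ∑ k, if i ≠ j ∧ v k j ≠ 0 then ‖v k i‖ ^ 2 else 0,
    fun i j => ?_, fun i => ?_, fun i j hij => ?_, fun i => ?_⟩
  · exact Finset.sum_nonneg fun k _ => by split_ifs <;> positivity
  · simp
  · have h1 : ‖∑ k, v k i * star (v k j)‖ ≤
        ∑ k, (if v k j ≠ 0 then ‖v k i‖ else 0) * (if v k i ≠ 0 then ‖v k j‖ else 0) := by
      refine (norm_sum_le _ _).trans (Finset.sum_le_sum fun k _ => ?_)
      by_cases hi : v k i = 0 <;> by_cases hj : v k j = 0 <;> simp [hi, hj]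
    refine (pow_le_pow_left₀ (norm_nonneg _) h1 2).trans ?_
    refine (Finset.sum_mul_sq_le_sq_mul_sq _ _ _).trans_eq ?_
    simp [ite_pow, hij, hij.symm]
  · rw [Finset.sum_comm]
    refine Finset.sum_le_sum fun k _ => ?_
    rw [← Finset.sum_filter, Finset.sum_const, nsmul_eq_mul]
    by_cases hi : v k i = 0
    · simp [hi]
    have hcard : (Finset.univ.filter fun j => i ≠ j ∧ v k j ≠ 0).card ≤ 1 := by
      have h := hv k
      rw [Set.ncard_eq_toFinset_card'] at h
      have heq : (Finset.univ.filter fun j => i ≠ j ∧ v k j ≠ 0)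
          = ({i | v k i ≠ 0} : Set (Fin n)).toFinset.erase i := by
        ext j
        simp [eq_comm]
      rw [heq, Finset.card_erase_of_mem (by simpa using hi)]
      omega
    exact mul_le_of_le_one_left (by positivity) (by exact_mod_cast hcard)

lemma ncard_support_single_add_single_le (i j : Fin n) (a b : 𝕜) :
    ({l | (Pi.single i a + Pi.single j b : Fin n → 𝕜) l ≠ 0} : Set (Fin n)).ncard ≤ 2 := by
  refine (Set.ncard_le_ncard (t := {i, j}) fun l hl => ?_).trans ((Set.ncard_insert_le i {j}).trans (by simp))
  by_contra h
  simp only [Set.mem_insert_iff, Set.mem_singleton_iff, not_or] at h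
  exact hl (by simp [h.1, h.2])

/-- A rank-one matrix supported on two indices, with prescribed entries. -/
lemma vecMulVec_single_add_single_apply {i j : Fin n} (hij : i ≠ j) {s t : ℝ} {z : 𝕜}
    (hs : 0 < s) (hst : s * t = ‖z‖ ^ 2) (a b : Fin n) :
    let w : Fin n → 𝕜 := Pi.single i ((√s : ℝ) : 𝕜) + Pi.single j (star z / ((√s : ℝ) : 𝕜))
    Matrix.vecMulVec w (star w) a b =
      (if a = i then if b = i then (s : 𝕜) else 0 else 0) +
      (if a = i then if b = j then z else 0 else 0) +
      (if a = j then if b = i then star z else 0 else 0) +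
      (if a = j then if b = j then (t : 𝕜) else 0 else 0) := by
  intro w
  have hsq : ((√s : ℝ) : 𝕜) * ((√s : ℝ) : 𝕜) = s := by
    rw [← RCLike.ofReal_mul, Real.mul_self_sqrt hs.le]
  have hne : ((√s : ℝ) : 𝕜) ≠ 0 := by
    simpa using (Real.sqrt_pos.2 hs).ne'
  have hs' : (s : 𝕜) ≠ 0 := by simpa using hs.ne'
  have ht : star z * z = s * t := by
    rw [← RCLike.ofReal_mul, hst, RCLike.star_def, RCLike.conj_mul]
    simp
  have hwi : w i = ((√s : ℝ) : 𝕜) := by simp [w, hij]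
  have hwj : w j = star z / ((√s : ℝ) : 𝕜) := by simp [w, hij.symm]
  have hw : ∀ l, l ≠ i → l ≠ j → w l = 0 := fun l h1 h2 => by simp [w, h1, h2]
  have hst' : star ((√s : ℝ) : 𝕜) = ((√s : ℝ) : 𝕜) := by simp
  rw [Matrix.vecMulVec_apply, Pi.star_apply]
  by_cases hai : a = i
  · subst hai
    by_cases hbi : b = a
    · subst hbi
      simp [hwi, hij, hsq]
    by_cases hbj : b = j
    · subst hbj
      rw [hwi, hwj, star_div₀, star_star, hst']
      simp [hij, hij.symm, mul_div_cancel₀ _ hne]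
    · simp [hw b hbi hbj, hbi, hbj]
  by_cases haj : a = j
  · subst haj
    by_cases hbi : b = i
    · subst hbi
      rw [hwi, hwj, hst', div_mul_cancel₀ _ hne]
      simp [hij, hij.symm]
    by_cases hbj : b = a
    · subst hbj
      rw [hwj, star_div₀, star_star, hst', div_mul_div_comm, hsq, ht, mul_div_cancel_left₀ _ hs']
      simp [hij.symm]
    · simp [hw b hbi hbj, hbi, hbj]
  · simp [hw a hai haj, hai, haj]

lemma hasFWDecomp_two_of_splitting {A : Matrix (Fin n) (Fin n) 𝕜} (hA : A.IsHermitian)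
    (hnz : ∀ i j, A i j ≠ 0) {x : Fin n → Fin n → ℝ} (hx0 : ∀ i j, 0 ≤ x i j)
    (hxd : ∀ i, x i i = 0) (hxp : ∀ i j, i ≠ j → x i j * x j i = ‖A i j‖ ^ 2)
    (hxs : ∀ i, ((∑ j, x i j : ℝ) : 𝕜) = A i i) :
    HasFWDecomp 2 (n * (n - 1) / 2) A := by
  have e : Fin (n * (n - 1) / 2) ≃ {p : Fin n × Fin n // p.1 < p.2} :=
    (Fintype.equivFinOfCardEq (card_lt_pairs n)).symm
  let w : Fin n × Fin n → Fin n → 𝕜 := fun p =>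
    Pi.single p.1 ((√(x p.1 p.2) : ℝ) : 𝕜) +
      Pi.single p.2 (star (A p.1 p.2) / ((√(x p.1 p.2) : ℝ) : 𝕜))
  refine ⟨fun k => w (e k), fun k => ncard_support_single_add_single_le _ _ _ _, ?_⟩
  rw [e.sum_comp (fun p => Matrix.vecMulVec (w p) (star (w p)))]
  have hpos : ∀ i j, i ≠ j → 0 < x i j := fun i j hij => by
    refine lt_of_le_of_ne (hx0 i j) fun h => ?_
    have := hxp i j hij
    rw [← h, zero_mul] at this
    have := norm_pos_iff.2 (hnz i j)
    nlinarith
  ext a b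
  rw [Matrix.sum_apply,
    Finset.sum_congr rfl fun p _ => vecMulVec_single_add_single_apply p.2.ne (hpos _ _ p.2.ne)
      (hxp _ _ p.2.ne) a b]
  rw [← Finset.sum_subtype (Finset.univ.filter fun p : Fin n × Fin n => p.1 < p.2) (by simp)
    (f := fun p : Fin n × Fin n =>
      (if a = p.1 then if b = p.1 then (x p.1 p.2 : 𝕜) else 0 else 0) +
      (if a = p.1 then if b = p.2 then A p.1 p.2 else 0 else 0) +
      (if a = p.2 then if b = p.1 then star (A p.1 p.2) else 0 else 0) +
      (if a = p.2 then if b = p.2 then (x p.2 p.1 : 𝕜) else 0 else 0))]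
  rw [Finset.sum_add_distrib, Finset.sum_add_distrib, Finset.sum_add_distrib]
  have h1 : ∑ p : Fin n × Fin n with p.1 < p.2,
      (if a = p.1 then if b = p.1 then (x p.1 p.2 : 𝕜) else 0 else 0)
      = if b = a then ∑ j, (if a < j then (x a j : 𝕜) else 0) else 0 := by
    rw [Finset.sum_filter, Fintype.sum_prod_type, Finset.sum_eq_single a]
    · by_cases h : b = a <;> simp [h]
    · intro i _ hi
      simp [hi.symm]
    · simp
  have h2 : ∑ p : Fin n × Fin n with p.1 < p.2,
      (if a = p.1 then if b = p.2 then A p.1 p.2 else 0 else 0)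
      = if a < b then A a b else 0 := by
    rw [Finset.sum_filter, Finset.sum_eq_single (a, b)]
    · simp
    · rintro ⟨i, j⟩ _ hi
      grind
    · simp
  have h3 : ∑ p : Fin n × Fin n with p.1 < p.2,
      (if a = p.2 then if b = p.1 then star (A p.1 p.2) else 0 else 0)
      = if b < a then A a b else 0 := by
    rw [Finset.sum_filter, Finset.sum_eq_single (b, a)]
    · simp [← hA.apply a b]
    · rintro ⟨i, j⟩ _ hi
      grind
    · simp
  have h4 : ∑ p : Fin n × Fin n with p.1 < p.2,
      (if a = p.2 then if b = p.2 then (x p.2 p.1 : 𝕜) else 0 else 0)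
      = if b = a then ∑ j, (if j < a then (x a j : 𝕜) else 0) else 0 := by
    rw [Finset.sum_filter, Fintype.sum_prod_type_right, Finset.sum_eq_single a]
    · by_cases h : b = a <;> simp [h]
    · intro i _ hi
      simp [hi.symm]
    · simp
  rw [h1, h2, h3, h4]
  rcases lt_trichotomy a b with h | h | h
  · simp [h, h.ne', h.not_gt]
  · subst h
    simp only [if_true, lt_irrefl, if_false, add_zero]
    rw [← hxs, ← Finset.sum_add_distrib, RCLike.ofReal_sum]
    refine Finset.sum_congr rfl fun j _ => ?_
    rcases lt_trichotomy a j with h | h | h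
    · simp [h, h.not_gt]
    · subst h
      simp [hxd]
    · simp [h, h.not_gt]
  · simp [h, h.ne, h.not_gt]

lemma exists_fin_map_no_two_cycle (hn : 3 ≤ n) :
    ∃ σ : Fin n → Fin n, (∀ i, σ i ≠ i) ∧ ∀ i, σ (σ i) ≠ i := by
  refine ⟨fun i => if h : (i : ℕ) + 1 < n then ⟨i + 1, h⟩ else ⟨0, by omega⟩,
    fun i h => ?_, fun i h => ?_⟩ <;>
  · rw [Fin.ext_iff] at h
    grind

theorem fran_two_of_no_zero_entries (hn : 3 ≤ n) (A : Matrix (Fin n) (Fin n) 𝕜)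
    (hA : A.PosSemidef) (h2 : FactorWidthAtMost 2 A) (hnz : ∀ i j, A i j ≠ 0) :
    fran 2 A = n * (n - 1) / 2 := by
  have hmem : HasFWDecomp 2 (n * (n - 1) / 2) A := by
    obtain ⟨r, v, hv, hdec⟩ := h2
    have hent : ∀ i j, ∑ k, v k i * star (v k j) = A i j := fun i j => by
      rw [hdec, Matrix.sum_apply]
      rfl
    have hne := nonempty_feasibleSplittings_of_decomp v hv
    simp only [hent] at hne
    obtain ⟨σ, hσ, hσ2⟩ := exists_fin_map_no_two_cycle hn
    obtain ⟨x, hx0, hxd, hxp, hxs⟩ := exists_tight_splitting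
      (fun i j => by rw [← hA.isHermitian.apply i j, norm_star])
      (fun i j => by have := norm_pos_iff.2 (hnz i j); positivity) σ hσ hσ2 hne
    refine hasFWDecomp_two_of_splitting hA.isHermitian hnz hx0 hxd hxp fun i => ?_
    rw [hxs, ← hent, RCLike.ofReal_sum]
    refine Finset.sum_congr rfl fun k _ => ?_
    rw [RCLike.star_def, RCLike.mul_conj, RCLike.ofReal_pow]
  exact le_antisymm (Nat.sInf_le hmem)
    (le_csInf ⟨_, hmem⟩ fun r hr => le_of_hasFWDecomp_two hnz hr)
end

section
/- Let k ≥ 2 and let A be an n×n positive semidefinite matrix over F (F = ℝ or ℂ) with factor width at most k and all entries nonzero. Then fran_k(A) ≥ C(n,k,2), where C(n,k,2) is the minimum size of an (n,k,2)-covering design. Furthermore, for all n ≥ k ≥ 2 there exists an n×n positive semidefinite matrix A with all entries nonzero and factor width at most k for which fran_k(A) = C(n,k,2). -/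
open Matrix
open scoped ComplexOrder

variable {𝕜 : Type*} [RCLike 𝕜] {n : ℕ}

/-- `C(n,k,2)`: the minimum number of `k`-element subsets of `{1,…,n}` needed so
that every pair of distinct elements is contained in at least one of them. -/
noncomputable def coveringNumber (n k : ℕ) : ℕ :=
  sInf {r | ∃ S : Fin r → Finset (Fin n), (∀ l, (S l).card = k) ∧
    ∀ i j : Fin n, i ≠ j → ∃ l, i ∈ S l ∧ j ∈ S l}

/-- The supports of a factor-width-`k` decomposition of a matrix with nonzero off-diagonal
entries, enlarged to `k`-element sets, form a covering design. -/
lemma coveringNumber_le_of_hasFWDecomp {k r : ℕ} (hkn : k ≤ n)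
    {A : Matrix (Fin n) (Fin n) 𝕜} (hA : ∀ i j, i ≠ j → A i j ≠ 0)
    (h : HasFWDecomp k r A) : coveringNumber n k ≤ r := by
  classical
  obtain ⟨v, hv, rfl⟩ := h
  have key : ∀ l, ∃ S : Finset (Fin n), (∀ i, v l i ≠ 0 → i ∈ S) ∧ S.card = k := by
    intro l
    have hl : (Finset.univ.filter fun i => v l i ≠ 0).card ≤ k := by
      simpa [← Set.ncard_coe_finset] using hv l
    obtain ⟨S, hS, hcard⟩ := Finset.exists_superset_card_eq hl (by simpa using hkn)
    exact ⟨S, fun i hi => hS (by simpa using hi), hcard⟩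
  choose S hS hcard using key
  refine Nat.sInf_le ⟨S, hcard, fun i j hij => ?_⟩
  have hne := hA i j hij
  rw [Matrix.sum_apply] at hne
  obtain ⟨l, -, hl⟩ := Finset.exists_ne_zero_of_sum_ne_zero hne
  rw [Matrix.vecMulVec_apply, Pi.star_apply] at hl
  exact ⟨l, hS l i (left_ne_zero_of_mul hl),
    hS l j (star_ne_zero.mp (right_ne_zero_of_mul hl))⟩

lemma le_fran_of_factorWidthAtMost {k : ℕ} (hkn : k ≤ n)
    {A : Matrix (Fin n) (Fin n) 𝕜} (hA : ∀ i j, i ≠ j → A i j ≠ 0)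
    (h : FactorWidthAtMost k A) : coveringNumber n k ≤ fran k A :=
  coveringNumber_le_of_hasFWDecomp hkn hA (Nat.sInf_mem h)

/-- The minimum defining `coveringNumber` is attained. -/
lemma exists_covering_design {k : ℕ} (hk : 2 ≤ k) (hkn : k ≤ n) :
    ∃ S : Fin (coveringNumber n k) → Finset (Fin n), (∀ l, (S l).card = k) ∧
      ∀ i j : Fin n, i ≠ j → ∃ l, i ∈ S l ∧ j ∈ S l := by
  classical
  let e := (Finset.powersetCard k (Finset.univ : Finset (Fin n))).equivFin.symm
  refine Nat.sInf_mem (s := {r | ∃ S : Fin r → Finset (Fin n), (∀ l, (S l).card = k) ∧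
    ∀ i j : Fin n, i ≠ j → ∃ l, i ∈ S l ∧ j ∈ S l}) ⟨_, fun l => (e l).1, fun l => ?_, ?_⟩
  · exact (Finset.mem_powersetCard.mp (e l).2).2
  · intro i j hij
    obtain ⟨T, hT, hcard⟩ := Finset.exists_superset_card_eq (s := {i, j}) (n := k)
      (by rwa [Finset.card_pair hij]) (by simpa using hkn)
    refine ⟨e.symm ⟨T, by simp [hcard]⟩, ?_, ?_⟩ <;>
      simpa using hT (by simp)

theorem fran_covering_design (n k : ℕ) (hk : 2 ≤ k) (hkn : k ≤ n) :
    (∀ A : Matrix (Fin n) (Fin n) 𝕜, A.PosSemidef → FactorWidthAtMost k A →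
      (∀ i j, A i j ≠ 0) → coveringNumber n k ≤ fran k A) ∧
    (∃ A : Matrix (Fin n) (Fin n) 𝕜, A.PosSemidef ∧ FactorWidthAtMost k A ∧
      (∀ i j, A i j ≠ 0) ∧ fran k A = coveringNumber n k) := by
  classical
  refine ⟨fun A _ hA hne => le_fran_of_factorWidthAtMost hkn (fun i j _ => hne i j) hA, ?_⟩
  obtain ⟨S, hcard, hS⟩ := exists_covering_design hk hkn
  let v : Fin (coveringNumber n k) → Fin n → 𝕜 := fun l i => if i ∈ S l then 1 else 0
  let A : Matrix (Fin n) (Fin n) 𝕜 := ∑ l, Matrix.vecMulVec (v l) (star (v l))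
  have hdecomp : HasFWDecomp k (coveringNumber n k) A := by
    refine ⟨v, fun l => ?_, rfl⟩
    have hsupp : {i | v l i ≠ 0} = (S l : Set (Fin n)) := by
      ext i
      simp [v]
    rw [hsupp, Set.ncard_coe_finset, hcard]
  have hcover : ∀ i j, ∃ l, i ∈ S l ∧ j ∈ S l := by
    intro i j
    by_cases hij : i = j
    · have : Nontrivial (Fin n) := Fin.nontrivial_iff_two_le.mpr (hk.trans hkn)
      obtain ⟨m, hm⟩ := exists_ne i
      obtain ⟨l, hl, -⟩ := hS i m hm.symm
      exact ⟨l, hl, hij ▸ hl⟩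
    · exact hS i j hij
  have hne : ∀ i j, A i j ≠ 0 := by
    intro i j
    have hA : A i j = ((Finset.univ.filter fun l => i ∈ S l ∧ j ∈ S l).card : 𝕜) := by
      simp only [A, v, Matrix.sum_apply, Matrix.vecMulVec_apply, Pi.star_apply, apply_ite star,
        star_one, star_zero, Finset.card_filter, Nat.cast_sum, Nat.cast_ite, Nat.cast_one,
        Nat.cast_zero, ite_and, mul_ite, mul_one, mul_zero]
      refine Finset.sum_congr rfl fun l _ => ?_
      split_ifs <;> rfl
    obtain ⟨l, hl⟩ := hcover i j
    rw [hA, Nat.cast_ne_zero]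
    exact Finset.card_ne_zero_of_mem (a := l) (by simpa using hl)
  refine ⟨A, ?_, ⟨_, hdecomp⟩, hne, le_antisymm (Nat.sInf_le hdecomp) ?_⟩
  · exact Matrix.posSemidef_sum _ fun l _ => Matrix.posSemidef_vecMulVec_self_star (v l)
  · exact le_fran_of_factorWidthAtMost hkn (fun i j _ => hne i j) ⟨_, hdecomp⟩
end

section
/- Let k ≥ 2 and let A be an n×n positive semidefinite matrix over F (F = ℝ or ℂ) with factor width at most k. Then fran_k(A) ≥ cc_k(G), where cc_k(G) is the minimum number r of subsets S_1, …, S_r of {1,…,n}, each of size k, such that every pair {i,j} with i ≠ j and a_{i,j} ≠ 0 is contained in at least one S_ℓ. -/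
open Matrix
open scoped ComplexOrder

variable {𝕜 : Type*} [RCLike 𝕜] {n : ℕ}

/-- The `k`-clique covering number of the graph whose edges are the pairs `{i,j}`
with `i ≠ j` and `A i j ≠ 0`: the minimum number of `k`-element vertex subsets
needed so that every such pair is contained in at least one of them. -/
noncomputable def cliqueCoverNumber (k : ℕ) (A : Matrix (Fin n) (Fin n) 𝕜) : ℕ :=
  sInf {r | ∃ S : Fin r → Finset (Fin n), (∀ l, (S l).card = k) ∧
    ∀ i j : Fin n, i ≠ j → A i j ≠ 0 → ∃ l, i ∈ S l ∧ j ∈ S l}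

/-- A nonzero entry of a sum of outer products comes from a vector whose support contains
both of its indices. -/
theorem exists_ne_zero_of_sum_vecMulVec_ne_zero {r : ℕ} {v : Fin r → Fin n → 𝕜} {i j : Fin n}
    (h : (∑ l, Matrix.vecMulVec (v l) (star (v l))) i j ≠ 0) :
    ∃ l, v l i ≠ 0 ∧ v l j ≠ 0 := by
  rw [Matrix.sum_apply] at h
  obtain ⟨l, -, hl⟩ := Finset.exists_ne_zero_of_sum_ne_zero h
  rw [Matrix.vecMulVec_apply, Pi.star_apply] at hl
  exact ⟨l, left_ne_zero_of_mul hl, star_ne_zero.mp (right_ne_zero_of_mul hl)⟩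

/-- If there are at least `k` indices, enlarging the supports of the vectors in a
factor-width-`k` decomposition to size `k` gives a `k`-clique covering. -/
theorem HasFWDecomp.exists_cliqueCover {k r : ℕ} {A : Matrix (Fin n) (Fin n) 𝕜}
    (h : HasFWDecomp k r A) (hkn : k ≤ n) :
    ∃ S : Fin r → Finset (Fin n), (∀ l, (S l).card = k) ∧
      ∀ i j : Fin n, i ≠ j → A i j ≠ 0 → ∃ l, i ∈ S l ∧ j ∈ S l := by
  classical
  obtain ⟨v, hv, rfl⟩ := h
  have hsupp : ∀ l, ∃ S : Finset (Fin n), {i | v l i ≠ 0}.toFinset ⊆ S ∧ S.card = k := fun l =>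
    Finset.exists_superset_card_eq ((Set.ncard_eq_toFinset_card' _).symm.trans_le (hv l))
      (by simpa using hkn)
  choose S hS hcard using hsupp
  refine ⟨S, hcard, fun i j _ hij => ?_⟩
  obtain ⟨l, hi, hj⟩ := exists_ne_zero_of_sum_vecMulVec_ne_zero hij
  exact ⟨l, hS l (by simpa using hi), hS l (by simpa using hj)⟩

/-- With fewer than `k` indices there are no `k`-element subsets, so only the empty family can
be a covering. -/
theorem cliqueCoverNumber_eq_zero_of_lt {k : ℕ} (A : Matrix (Fin n) (Fin n) 𝕜) (hnk : n < k) :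
    cliqueCoverNumber k A = 0 := by
  by_contra hne
  obtain ⟨S, hS, -⟩ := Nat.sInf_mem (Nat.nonempty_of_pos_sInf (Nat.pos_of_ne_zero hne))
  have hle := card_finset_fin_le (S ⟨0, Nat.pos_of_ne_zero hne⟩)
  rw [hS] at hle
  omega

theorem fran_ge_cliqueCoverNumber (k : ℕ) (hk : 2 ≤ k) (A : Matrix (Fin n) (Fin n) 𝕜)
    (hA : A.PosSemidef) (hFW : FactorWidthAtMost k A) :
    cliqueCoverNumber k A ≤ fran k A := by
  rcases le_or_gt k n with hkn | hnk
  · have hmin : HasFWDecomp k (fran k A) A := Nat.sInf_mem hFW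
    exact Nat.sInf_le (hmin.exists_cliqueCover hkn)
  · rw [cliqueCoverNumber_eq_zero_of_lt A hnk]
    exact Nat.zero_le _
end

section
/- Let A and B be n×n positive semidefinite matrices over F (F = ℝ or ℂ), each with factor width at most k. Then the Hadamard product A ⊙ B has factor width at most k, and fran_k(A ⊙ B) ≤ fran_k(A) · fran_k(B). -/
open Matrix
open scoped ComplexOrder

variable {𝕜 : Type*} [RCLike 𝕜] {n : ℕ}

theorem Matrix.vecMulVec_star_hadamard (u v : Fin n → 𝕜) :
    vecMulVec u (star u) ⊙ vecMulVec v (star v) = vecMulVec (u * v) (star (u * v)) := by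
  ext a b
  simp only [hadamard_apply, vecMulVec_apply, Pi.star_apply, Pi.mul_apply, star_mul']
  ring

theorem HasFWDecomp.hadamard {k r s : ℕ} {A B : Matrix (Fin n) (Fin n) 𝕜}
    (hA : HasFWDecomp k r A) (hB : HasFWDecomp k s B) :
    HasFWDecomp k (r * s) (A ⊙ B) := by
  obtain ⟨u, hu, rfl⟩ := hA
  obtain ⟨v, -, rfl⟩ := hB
  refine ⟨fun j => u (finProdFinEquiv.symm j).1 * v (finProdFinEquiv.symm j).2,
    fun j => ?_, ?_⟩
  · exact (Set.ncard_le_ncard (fun i hi => left_ne_zero_of_mul hi) (Set.toFinite _)).trans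
      (hu (finProdFinEquiv.symm j).1)
  · rw [Equiv.sum_comp finProdFinEquiv.symm
      fun p : Fin r × Fin s => vecMulVec (u p.1 * v p.2) (star (u p.1 * v p.2)),
      Fintype.sum_prod_type]
    simp only [← vecMulVec_star_hadamard]
    ext a b
    simp only [hadamard_apply, Matrix.sum_apply, Finset.sum_mul_sum]

theorem FactorWidthAtMost.hasFWDecomp_fran {k : ℕ} {A : Matrix (Fin n) (Fin n) 𝕜}
    (h : FactorWidthAtMost k A) : HasFWDecomp k (fran k A) A :=
  Nat.sInf_mem h

theorem HasFWDecomp.fran_le {k r : ℕ} {A : Matrix (Fin n) (Fin n) 𝕜}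
    (h : HasFWDecomp k r A) : fran k A ≤ r :=
  Nat.sInf_le h

theorem hadamard_factorWidth (k : ℕ) (A B : Matrix (Fin n) (Fin n) 𝕜)
    (hA : A.PosSemidef) (hB : B.PosSemidef)
    (hAk : FactorWidthAtMost k A) (hBk : FactorWidthAtMost k B) :
    FactorWidthAtMost k (Matrix.hadamard A B) ∧
    fran k (Matrix.hadamard A B) ≤ fran k A * fran k B := by
  have h := hAk.hasFWDecomp_fran.hadamard hBk.hasFWDecomp_fran
  exact ⟨⟨_, h⟩, h.fran_le⟩
end

section
/- Let s ≥ 1 be an integer and let A be an n×n positive semidefinite matrix over F (F = ℝ or ℂ) with factor width at most k. Then the s-th Hadamard power A^{⊙s} has factor width at most k, and fran_k(A^{⊙s}) ≤ binomial(fran_k(A) + s − 1, s). -/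
open Matrix
open scoped ComplexOrder

variable {𝕜 : Type*} [RCLike 𝕜] {n : ℕ}

/-- A family of outer products indexed by a finite type gives a factor-width decomposition. -/
theorem HasFWDecomp.of_fintype {ι : Type*} [Fintype ι] {k : ℕ} {A : Matrix (Fin n) (Fin n) 𝕜}
    (v : ι → Fin n → 𝕜) (hv : ∀ j, ({i | v j i ≠ 0} : Set (Fin n)).ncard ≤ k)
    (hA : A = ∑ j, Matrix.vecMulVec (v j) (star (v j))) :
    HasFWDecomp k (Fintype.card ι) A := by
  refine ⟨fun j => v ((Fintype.equivFin ι).symm j), fun j => hv _, ?_⟩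
  rw [hA]
  exact ((Fintype.equivFin ι).symm.sum_comp fun j => Matrix.vecMulVec (v j) (star (v j))).symm

/-- The multinomial expansion of the Hadamard power of a factor-width decomposition. -/
theorem HasFWDecomp.hadamard_pow {k r s : ℕ} (hs : 1 ≤ s) {A : Matrix (Fin n) (Fin n) 𝕜}
    (h : HasFWDecomp k r A) :
    HasFWDecomp k ((r + s - 1).choose s) (Matrix.of fun i j => (A i j) ^ s) := by
  obtain ⟨v, hv, rfl⟩ := h
  have key := HasFWDecomp.of_fintype (ι := Sym (Fin r) s) (k := k)
    (A := Matrix.of fun i j => ((∑ a, Matrix.vecMulVec (v a) (star (v a))) i j) ^ s)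
    (fun m i => ((√m.1.countPerms : ℝ) : 𝕜) *
      (m.1.map fun a => v a i).prod) ?_ ?_
  · rwa [Sym.card_sym_eq_choose, Fintype.card_fin] at key
  · intro m
    obtain ⟨a, ha⟩ : ∃ a, a ∈ m.1 :=
      Multiset.card_pos_iff_exists_mem.mp (hs.trans m.2.ge)
    refine (Set.ncard_le_ncard ?_ (Set.toFinite _)).trans (hv a)
    intro i hi hz
    exact hi (mul_eq_zero_of_right _ (Multiset.prod_eq_zero (Multiset.mem_map.mpr ⟨a, ha, hz⟩)))
  · ext i j
    simp only [Matrix.of_apply, Matrix.sum_apply, Matrix.vecMulVec_apply, Pi.star_apply]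
    rw [Finset.sum_pow, Finset.sym_univ]
    refine Finset.sum_congr rfl fun m _ => ?_
    have hsq : ((√m.1.countPerms : ℝ) : 𝕜) *
        ((√m.1.countPerms : ℝ) : 𝕜) =
        (m.1.countPerms : 𝕜) := by
      rw [← RCLike.ofReal_mul, Real.mul_self_sqrt (Nat.cast_nonneg _), RCLike.ofReal_natCast]
    have hstar : star ((m.1.map fun a => v a j).prod) =
        (m.1.map fun a => star (v a j)).prod := by
      rw [← starRingEnd_apply, map_multiset_prod, Multiset.map_map]
      rfl
    rw [star_mul', hstar, Multiset.prod_map_mul, ← hsq, ← starRingEnd_apply, RCLike.conj_ofReal]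
    ring

theorem hadamard_pow_factorWidth (k s : ℕ) (hs : 1 ≤ s)
    (A : Matrix (Fin n) (Fin n) 𝕜) (hA : A.PosSemidef) (hFW : FactorWidthAtMost k A) :
    FactorWidthAtMost k (Matrix.of fun i j => (A i j) ^ s) ∧
    fran k (Matrix.of fun i j => (A i j) ^ s) ≤ (fran k A + s - 1).choose s := by
  have hdecomp : HasFWDecomp k (fran k A) A := Nat.sInf_mem hFW
  exact ⟨⟨_, hdecomp.hadamard_pow hs⟩, Nat.sInf_le (hdecomp.hadamard_pow hs)⟩
end

section
/- Let A be an n×n real positive semidefinite matrix with all entries nonnegative such that every 2×2 principal submatrix of A is positive definite. Then there exists a natural number M such that for every natural number m ≥ M, the m-th Hadamard power A^{⊙m} has factor width at most 2. -/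
open Matrix
open scoped ComplexOrder

variable {𝕜 : Type*} [RCLike 𝕜] {n : ℕ}

namespace FactorWidthAtMost

lemma zero (k : ℕ) : FactorWidthAtMost k (0 : Matrix (Fin n) (Fin n) 𝕜) :=
  ⟨0, Fin.elim0, fun j => j.elim0, by simp⟩

lemma add_s19 {k : ℕ} {A B : Matrix (Fin n) (Fin n) 𝕜} (hA : FactorWidthAtMost k A)
    (hB : FactorWidthAtMost k B) : FactorWidthAtMost k (A + B) := by
  obtain ⟨r, v, hv, rfl⟩ := hA
  obtain ⟨s, w, hw, rfl⟩ := hB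
  refine ⟨r + s, Fin.append v w, fun j => ?_, by simp [Fin.sum_univ_add]⟩
  induction j using Fin.addCases with
  | left j => simpa using hv j
  | right j => simpa using hw j

lemma sum_s19 {k : ℕ} {ι : Type*} (s : Finset ι) {A : ι → Matrix (Fin n) (Fin n) 𝕜}
    (hA : ∀ i ∈ s, FactorWidthAtMost k (A i)) : FactorWidthAtMost k (∑ i ∈ s, A i) :=
  Finset.sum_induction _ _ (fun _ _ => add_s19) (zero k) hA

lemma smul_vecMulVec {k : ℕ} {c : ℝ} (hc : 0 ≤ c) {v : Fin n → ℝ}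
    (hv : ({i | v i ≠ 0} : Set (Fin n)).ncard ≤ k) :
    FactorWidthAtMost k (c • vecMulVec v v) := by
  refine ⟨1, fun _ => √c • v, fun _ => ?_, ?_⟩
  · refine (Set.ncard_le_ncard (fun i hi => ?_) (Set.toFinite _)).trans hv
    exact right_ne_zero_of_mul (a := √c) (by simpa using hi)
  · ext i j
    simp only [Matrix.smul_apply, vecMulVec_apply, smul_eq_mul, Finset.univ_unique,
      Finset.sum_const, Finset.card_singleton, one_smul, star_trivial, Pi.smul_apply]
    linear_combination (-(v i * v j)) * Real.mul_self_sqrt hc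

/-- A diagonal congruence of a symmetric, nonnegative, diagonally dominant matrix has factor width
at most two. -/
lemma two_of_diagDominant (d : Fin n → ℝ) {R : Matrix (Fin n) (Fin n) ℝ} (hR : R.IsSymm)
    (hnn : ∀ i j, 0 ≤ R i j) (hdom : ∀ i, ∑ j, (if i = j then 0 else R i j) ≤ R i i) :
    FactorWidthAtMost 2 (Matrix.of fun i j => d i * d j * R i j) := by
  set O : Fin n → Fin n → ℝ := fun i j => if i = j then 0 else R i j with hO
  have hO_symm (i j) : O i j = O j i := by simp only [hO, eq_comm (a := i), hR.apply i j]
  have hO_nonneg (i j) : 0 ≤ O i j := by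
    simp only [hO]
    split_ifs
    exacts [le_rfl, hnn i j]
  have key : (Matrix.of fun i j => d i * d j * R i j) =
      (∑ i, (R i i - ∑ j, O i j) • vecMulVec (Pi.single i (d i)) (Pi.single i (d i))) +
      ∑ i, ∑ j, (O i j / 2) • vecMulVec (Pi.single i (d i) + Pi.single j (d j))
        (Pi.single i (d i) + Pi.single j (d j)) := by
    ext k l
    simp only [of_apply, Matrix.add_apply, Matrix.sum_apply, Matrix.smul_apply, vecMulVec_apply,
      Pi.add_apply, Pi.single_apply, smul_eq_mul, mul_add, add_mul, Finset.sum_add_distrib,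
      mul_ite, ite_mul,
      mul_zero, zero_mul, Finset.sum_ite_eq, Finset.mem_univ, if_true, Finset.sum_ite_irrel,
      Finset.sum_const_zero]
    by_cases hkl : k = l
    · subst hkl
      have hO_diag : O k k = 0 := if_pos rfl
      simp only [if_true, ← Finset.sum_mul, ← Finset.sum_div, hO_symm _ k, hO_diag]
      ring
    · have hO_off : O k l = R k l := if_neg hkl
      simp only [hkl, if_false, hO_symm l k, hO_off]
      ring
  rw [key]
  refine add_s19 (sum_s19 _ fun i _ => smul_vecMulVec (sub_nonneg.2 (hdom i)) ?_)
    (sum_s19 _ fun i _ => sum_s19 _ fun j _ =>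
      smul_vecMulVec (div_nonneg (hO_nonneg i j) zero_le_two) ?_)
  · refine (Set.ncard_le_ncard (t := {i}) (fun k hk => ?_) (Set.toFinite _)).trans (by simp)
    by_contra h
    simp_all
  · refine (Set.ncard_le_ncard (t := {i, j}) (fun k hk => ?_) (Set.toFinite _)).trans ?_
    swap
    · rw [← Finset.coe_pair, Set.ncard_coe_finset]
      exact Finset.card_le_two
    by_contra h
    simp_all

end FactorWidthAtMost

theorem eventually_factorWidthAtMost_two (A : Matrix (Fin n) (Fin n) ℝ)
    (hA : A.PosSemidef) (hnn : ∀ i j, 0 ≤ A i j)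
    (h2 : ∀ i j : Fin n, i ≠ j → (!![A i i, A i j; A j i, A j j]).PosDef) :
    ∃ M : ℕ, ∀ m : ℕ, M ≤ m →
      FactorWidthAtMost 2 (Matrix.of fun i j => (A i j) ^ m) := by
  have hdiag (i) : 0 ≤ A i i := hnn i i
  have hsymm (i j) : A i j = A j i := by simpa using hA.isHermitian.apply j i
  set ρ : Fin n → Fin n → ℝ := fun i j => A i j / (√(A i i) * √(A j j)) with hρ
  have hρ_nonneg (i j) : 0 ≤ ρ i j := div_nonneg (hnn i j) (by positivity)
  have hsqrt_pos (i j) (hij : i ≠ j) : 0 < √(A i i) :=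
    Real.sqrt_pos.2 (by simpa using (h2 i j hij).diag_pos (i := 0))
  have hρ_lt (i j) (hij : i ≠ j) : ρ i j < 1 := by
    have hdet := (h2 i j hij).det_pos
    rw [det_fin_two_of, hsymm j i] at hdet
    rw [hρ, div_lt_one (mul_pos (hsqrt_pos i j hij) (hsqrt_pos j i hij.symm)),
      ← Real.sqrt_mul (hdiag i)]
    exact Real.lt_sqrt_of_sq_lt (by linarith [sq (A i j)])
  have hlim (i) : Filter.Tendsto (fun m : ℕ => ∑ j, if i = j then 0 else ρ i j ^ m)
      Filter.atTop (nhds 0) := by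
    suffices h : Filter.Tendsto (fun m : ℕ => ∑ j, if i = j then 0 else ρ i j ^ m)
        Filter.atTop (nhds (∑ _j : Fin n, 0)) by rwa [Finset.sum_const_zero] at h
    refine tendsto_finsetSum _ fun j _ => ?_
    split_ifs with hij
    · exact tendsto_const_nhds
    · exact tendsto_pow_atTop_nhds_zero_of_lt_one (hρ_nonneg i j) (hρ_lt i j hij)
  have hev : ∀ᶠ m : ℕ in Filter.atTop, ∀ i, ∑ j, (if i = j then 0 else ρ i j ^ m) ≤ 1 :=
    Filter.eventually_all.2 fun i => (hlim i).eventually_le_const one_pos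
  obtain ⟨M, hM⟩ := Filter.eventually_atTop.1 hev
  refine ⟨M, fun m hm => ?_⟩
  have hdom := FactorWidthAtMost.two_of_diagDominant (fun i => √(A i i) ^ m)
    (R := Matrix.of fun i j => if i = j then 1 else ρ i j ^ m) ?_ ?_ ?_
  · convert hdom using 2
    ext i j
    by_cases hij : i = j
    · subst hij
      simp [← mul_pow, Real.mul_self_sqrt (hdiag i)]
    · have hi := (hsqrt_pos i j hij).ne'
      have hj := (hsqrt_pos j i (Ne.symm hij)).ne'
      simp only [of_apply, hij, if_false, hρ, ← mul_pow]
      congr 1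
      field_simp
  · ext i j
    simp only [hρ, transpose_apply, of_apply, eq_comm (a := j), hsymm j i,
      mul_comm (√(A j j))]
  · intro i j
    simp only [of_apply]
    split_ifs
    exacts [zero_le_one, pow_nonneg (hρ_nonneg i j) m]
  · intro i
    refine le_of_eq_of_le (Finset.sum_congr rfl fun j _ => ?_) ((hM m hm i).trans_eq (by simp))
    by_cases hij : i = j <;> simp [hij]
end
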